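/- arXiv:2402.01638 — 3 statements merged into one kernel-verified Lean document; each statement's English description precedes it below -/
import Mathlib

section
/- Let G = SL(2, 𝔽₅) and let f and λ be the characters of two non-isomorphic irreducible 2-dimensional complex representations of G. Then ⟨λ, f^n⟩ = 0 for every n with 1 ≤ n ≤ 6, and ⟨λ, f⁷⟩ = 1; that is, λ occurs in the 7-th tensor power of f with multiplicity exactly one and does not occur in any lower tensor power. -/
/-- The inner product `⟨α, β⟩ = (1/|G|) · Σ_{g ∈ G} conj (α g) * β g` of class functions
(e.g. characters) on a finite group `G`. -/
noncomputable def innerChar (G : Type*) [Fintype G] (α β : G → ℂ) : ℂ :=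
  (Fintype.card G : ℂ)⁻¹ * ∑ g : G, (starRingEnd ℂ) (α g) * β g

open Matrix

abbrev G5 := Matrix.SpecialLinearGroup (Fin 2) (ZMod 5)

def gS : G5 := ⟨!![0, 4; 1, 0], by decide⟩
def gT : G5 := ⟨!![1, 1; 0, 1], by decide⟩
def gL : G5 := ⟨!![1, 0; 4, 1], by decide⟩
def gZ : G5 := ⟨!![4, 0; 0, 4], by decide⟩

/-- Representatives of the nine conjugacy classes. -/
def rep5 : Fin 9 → G5 :=
  ![1, gZ, gS, gS * gT, gZ * (gS * gT), gT, gT * gT, gZ * gT, gZ * (gT * gT)]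

/-- The index of the conjugacy class. -/
def cls5 (g : G5) : Fin 9 :=
  if g = 1 then 0 else if g = gZ then 1 else
  if g.1 0 0 + g.1 1 1 = 0 then 2 else
  if g.1 0 0 + g.1 1 1 = 1 then 3 else
  if g.1 0 0 + g.1 1 1 = 4 then 4 else
  if g.1 0 0 + g.1 1 1 = 2 then
    (if g.1 0 1 = 1 ∨ g.1 0 1 = 4 ∨ g.1 1 0 = 1 ∨ g.1 1 0 = 4 then 5 else 6)
  else (if g.1 0 1 = 1 ∨ g.1 0 1 = 4 ∨ g.1 1 0 = 1 ∨ g.1 1 0 = 4 then 7 else 8)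

def mk5 (a b c d : ZMod 5) (h : (!![a, b; c, d]).det = 1) : G5 := ⟨!![a, b; c, d], h⟩

theorem cls5_conj_aux : ∀ a b c d : ZMod 5, ∀ h : (!![a, b; c, d]).det = 1,
    ∃ p q r s : ZMod 5, ∃ h' : (!![p, q; r, s]).det = 1,
      mk5 p q r s h' * mk5 a b c d h = rep5 (cls5 (mk5 a b c d h)) * mk5 p q r s h' := by
  decide +kernel

theorem gen5_aux : ∀ a b c d : ZMod 5, ∀ h : (!![a, b; c, d]).det = 1,
    ∃ i j k l : Fin 5, (⟨!![a, b; c, d], h⟩ : G5) =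
      gT ^ i.1 * gL ^ j.1 * gT ^ k.1 * gL ^ l.1 := by
  decide +kernel

theorem ex5 (g : G5) : ∃ a b c d : ZMod 5, ∃ h : (!![a, b; c, d]).det = 1,
    g = ⟨!![a, b; c, d], h⟩ := by
  have e : g.1 = !![g.1 0 0, g.1 0 1; g.1 1 0, g.1 1 1] := Matrix.eta_fin_two g.1
  refine ⟨g.1 0 0, g.1 0 1, g.1 1 0, g.1 1 1, ?_, ?_⟩
  · rw [← e]; exact g.2
  · exact Subtype.ext e

theorem cls5_conj (g : G5) : ∃ h : G5, h * g = rep5 (cls5 g) * h := by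
  obtain ⟨a, b, c, d, h, rfl⟩ := ex5 g
  obtain ⟨p, q, r, s, h', e⟩ := cls5_conj_aux a b c d h
  exact ⟨_, e⟩

theorem gen5 (g : G5) : ∃ i j k l : ℕ, g = gT ^ i * gL ^ j * gT ^ k * gL ^ l := by
  obtain ⟨a, b, c, d, h, rfl⟩ := ex5 g
  obtain ⟨i, j, k, l, e⟩ := gen5_aux a b c d h
  exact ⟨_, _, _, _, e⟩

theorem fib5 : ∀ i : Fin 9, (Finset.univ.filter fun g : G5 => cls5 g = i).card =
    (![1, 1, 30, 20, 20, 12, 12, 12, 12] : Fin 9 → ℕ) i := by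
  decide +kernel

theorem card5 : Fintype.card G5 = 120 := by
  decide +kernel

theorem sum5 (F : Fin 9 → ℂ) : ∑ g : G5, F (cls5 g) =
    F 0 + F 1 + 30 * F 2 + 20 * F 3 + 20 * F 4 + 12 * F 5 + 12 * F 6 + 12 * F 7 + 12 * F 8 := by
  rw [← Finset.sum_fiberwise (s := Finset.univ) (g := cls5)]
  have : ∀ i : Fin 9, ∑ g ∈ Finset.univ.filter (fun g : G5 => cls5 g = i), F (cls5 g) =
      ((![1, 1, 30, 20, 20, 12, 12, 12, 12] : Fin 9 → ℕ) i : ℂ) * F i := by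
    intro i
    rw [← fib5 i, Finset.sum_congr rfl (g := fun _ => F i)]
    · simp
    · intro x hx
      rw [(Finset.mem_filter.mp hx).2]
  simp only [this]
  simp [Fin.sum_univ_succ]
  ring_nf

abbrev M2 := Matrix (Fin 2) (Fin 2) ℂ

theorem ch2 (A : M2) (h : A.det = 1) : A * A = A.trace • A - 1 := by
  rw [Matrix.det_fin_two] at h
  ext i j
  fin_cases i <;> fin_cases j <;>
    simp [Matrix.mul_apply, Fin.sum_univ_two, Matrix.trace_fin_two] <;>
    first | ring1 | linear_combination -h

theorem nonscalar (A B : M2) (h : A * B ≠ B * A) (x y : ℂ) (e : x • A = y • (1 : M2)) :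
    x = 0 ∧ y = 0 := by
  have hx : x = 0 := by
    by_contra hx
    apply h
    have : A = (x⁻¹ * y) • (1 : M2) := by
      rw [mul_smul, ← e, smul_smul, inv_mul_cancel₀ hx, one_smul]
    rw [this]; simp
  subst hx
  refine ⟨rfl, ?_⟩
  have := congrFun (congrFun e 0) 0
  simpa using this.symm

theorem core5 (R : G5 →* M2) (hnc : R gS * R gT ≠ R gT * R gS) :
    R gZ = -1 ∧ (R gS).trace = 0 ∧ (R (gS * gT)).trace = 1 ∧
    (R gT).trace ^ 2 + (R gT).trace - 1 = 0 ∧ (R (gT * gT)).trace = (R gT).trace ^ 2 - 2 := by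
  have hcomm : ∀ g x y : G5, x * y = g * (y * x) → (R g).det = 1 := by
    intro g x y h
    have h1 : (R x).det * (R y).det = (R g).det * ((R y).det * (R x).det) := by
      simp only [← Matrix.det_mul, ← map_mul, h]
    have hu : ∀ x : G5, (R x).det ≠ 0 := by
      intro x hx
      have : (R (x * x⁻¹)).det = 1 := by simp
      rw [map_mul, Matrix.det_mul, hx] at this
      simp at this
    have := mul_ne_zero (hu x) (hu y)
    apply mul_right_cancel₀ this
    linear_combination -h1
  have dS : (R gS).det = 1 := hcomm gS ⟨!![0, 2; 2, 0], by decide⟩ ⟨!![1, 1; 2, 3], by decide⟩ (by decide +kernel)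
  have dT : (R gT).det = 1 := hcomm gT ⟨!![1, 3; 0, 1], by decide⟩ ⟨!![2, 0; 0, 3], by decide⟩ (by decide +kernel)
  have dU : (R gS * R gT).det = 1 := by rw [Matrix.det_mul, dS, dT, one_mul]
  have cS := ch2 _ dS
  have cT := ch2 _ dT
  have cU := ch2 _ dU
  have hZ : R gZ = R gS * R gS := by
    rw [← map_mul]; exact congrArg R (by decide +kernel)
  have hS4 : (R gS * R gS) * (R gS * R gS) = 1 := by
    rw [← map_mul, ← map_mul, ← map_one R]; exact congrArg R (by decide +kernel)
  have hU3 : (R gS * R gT) * ((R gS * R gT) * (R gS * R gT)) = R gZ := by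
    simp only [← map_mul]; exact congrArg R (by decide +kernel)
  have hT5 : R gT * ((R gT * R gT) * (R gT * R gT)) = 1 := by
    simp only [← map_mul]; rw [← map_one R]; exact congrArg R (by decide +kernel)
  have hnU : (R gS * R gT) * R gT ≠ R gT * (R gS * R gT) := by
    intro h
    apply hnc
    have : R gT * R (gT⁻¹) = 1 := by rw [← map_mul]; simp
    have h2 := congrArg (· * R (gT⁻¹)) h
    simp only [Matrix.mul_assoc, this, Matrix.mul_one] at h2
    exact h2
  rw [hZ, map_mul, map_mul] 
  have trS : (R gS).trace = 0 := by
    set A := R gS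
    set a := A.trace
    have : (a ^ 3 - 2 * a) • A = (a ^ 2) • (1 : M2) := by
      have e : (a • A - 1) * (a • A - 1) = (a ^ 3 - 2 * a) • A - (a ^ 2 - 1) • (1 : M2) := by
        simp only [Matrix.sub_mul, Matrix.mul_sub, Matrix.smul_mul, Matrix.mul_smul, cS,
          Matrix.mul_one, Matrix.one_mul]
        module
      rw [cS, e] at hS4
      rw [sub_eq_iff_eq_add] at hS4
      rw [hS4]; module
    have := (nonscalar A _ hnc _ _ this).2
    exact pow_eq_zero_iff (two_ne_zero) |>.mp this
  have hSS : R gS * R gS = -1 := by rw [cS, trS]; simp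
  refine ⟨hSS, trS, ?_, ?_, ?_⟩
  · set A := R gS * R gT
    set a := A.trace
    have : (a ^ 2 - 1) • A = (a - 1) • (1 : M2) := by
      have e : A * (a • A - 1) = (a ^ 2 - 1) • A - a • (1 : M2) := by
        simp only [Matrix.mul_sub, Matrix.mul_smul, cU, Matrix.mul_one]
        module
      rw [cU, e, hZ, hSS, sub_eq_iff_eq_add] at hU3
      rw [hU3]; module
    have := (nonscalar A _ hnU _ _ this).2
    linear_combination this
  · set A := R gT
    set a := A.trace
    have : (a ^ 4 - 3 * a ^ 2 + 1) • A = (a ^ 3 - 2 * a + 1) • (1 : M2) := by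
      have e : A * ((a • A - 1) * (a • A - 1)) =
          (a ^ 4 - 3 * a ^ 2 + 1) • A - (a ^ 3 - 2 * a) • (1 : M2) := by
        simp only [Matrix.sub_mul, Matrix.mul_sub, Matrix.smul_mul, Matrix.mul_smul, cT,
          Matrix.mul_one, Matrix.one_mul]
        module
      rw [cT, e, sub_eq_iff_eq_add] at hT5
      rw [hT5]; module
    obtain ⟨h1, h2⟩ := nonscalar A _ hnc.symm _ _ this
    linear_combination a * h2 - h1
  · rw [cT]
    simp [Matrix.trace_fin_two]
    ring

/-- The character table row. -/
noncomputable def row5 (t : ℂ) : Fin 9 → ℂ := ![2, -2, 0, 1, -1, t, -1 - t, -t, 1 + t]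

theorem noncomm5 (ρ : Representation ℂ G5 (Fin 2 → ℂ))
    (hirr : ∀ p : Submodule ℂ (Fin 2 → ℂ), (∀ g, ∀ v ∈ p, ρ g v ∈ p) → p = ⊥ ∨ p = ⊤) :
    ρ gS * ρ gT ≠ ρ gT * ρ gS := by
  intro hc
  -- Schur
  have schur : ∀ X : Module.End ℂ (Fin 2 → ℂ), (∀ g, ρ g * X = X * ρ g) →
      ∃ μ : ℂ, ∀ v, X v = μ • v := by
    intro X hX
    obtain ⟨μ, hμ⟩ := Module.End.exists_eigenvalue X
    refine ⟨μ, ?_⟩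
    rcases hirr (Module.End.eigenspace X μ) (by
      intro g v hv
      rw [Module.End.mem_eigenspace_iff] at hv ⊢
      have := LinearMap.congr_fun (hX g) v
      simp only [Module.End.mul_apply] at this
      rw [← this, hv, map_smul]) with h | h
    · exact absurd h hμ
    · intro v
      have : v ∈ Module.End.eigenspace X μ := by rw [h]; trivial
      exact Module.End.mem_eigenspace_iff.mp this
  have hLS : gL * gS = gS * gT := by decide +kernel
  have hSi : ρ gS * ρ gS⁻¹ = 1 := by rw [← map_mul]; simp
  have hL : ρ gL = ρ gT := by
    have h1 : ρ gL * ρ gS = ρ gT * ρ gS := by rw [← hc, ← map_mul, ← map_mul, hLS]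
    have := congrArg (· * ρ gS⁻¹) h1
    simpa only [mul_assoc, hSi, mul_one] using this
  have hpow : ∀ g, ∃ n : ℕ, ρ g = ρ gT ^ n := by
    intro g
    obtain ⟨i, j, k, l, rfl⟩ := gen5 g
    refine ⟨i + j + k + l, ?_⟩
    simp only [map_mul, map_pow, hL, pow_add]
  obtain ⟨μ, hμ⟩ := schur (ρ gT) (by
    intro g
    obtain ⟨n, hn⟩ := hpow g
    rw [hn, ← pow_succ, ← pow_succ'])
  have hn : ∀ n : ℕ, ∀ v, (ρ gT ^ n) v = μ ^ n • v := by
    intro n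
    induction n with
    | zero => intro v; simp
    | succ n ih => intro v; rw [pow_succ, Module.End.mul_apply, hμ, map_smul, ih, smul_smul, pow_succ']
  have := hirr (Submodule.span ℂ {![1, 0]}) (by
    intro g v hv
    obtain ⟨n, hg⟩ := hpow g
    rw [hg, hn]
    exact Submodule.smul_mem _ _ hv)
  rcases this with h | h
  · rw [Submodule.span_singleton_eq_bot] at h
    have := congrFun h 0
    simp at this
  · have h1 : (![0, 1] : Fin 2 → ℂ) ∈ Submodule.span ℂ {(![1, 0] : Fin 2 → ℂ)} := by
      rw [h]; trivial
    obtain ⟨c, hc⟩ := Submodule.mem_span_singleton.mp h1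
    have := congrFun hc 1
    simp at this

theorem char5 (ρ : Representation ℂ G5 (Fin 2 → ℂ))
    (hirr : ∀ p : Submodule ℂ (Fin 2 → ℂ), (∀ g, ∀ v ∈ p, ρ g v ∈ p) → p = ⊥ ∨ p = ⊤) :
    ∃ t : ℂ, t ^ 2 + t - 1 = 0 ∧
      ∀ g, LinearMap.trace ℂ (Fin 2 → ℂ) (ρ g) = row5 t (cls5 g) := by
  have hnc := noncomm5 ρ hirr
  let E : Module.End ℂ (Fin 2 → ℂ) ≃ₐ[ℂ] M2 := LinearMap.toMatrixAlgEquiv'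
  let R : G5 →* M2 := (E : Module.End ℂ (Fin 2 → ℂ) →* M2).comp ρ
  have hR : ∀ g, R g = E (ρ g) := fun g => rfl
  have htr : ∀ g, LinearMap.trace ℂ (Fin 2 → ℂ) (ρ g) = (R g).trace := by
    intro g
    rw [LinearMap.trace_eq_matrix_trace ℂ (Pi.basisFun ℂ (Fin 2))]
    rfl
  have hnc' : R gS * R gT ≠ R gT * R gS := by
    rw [hR, hR]
    intro h
    exact hnc (E.injective (by rw [map_mul E, map_mul E]; exact h))
  obtain ⟨hZ, hS, hU, hT, hTT⟩ := core5 R hnc'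
  refine ⟨(R gT).trace, hT, fun g => ?_⟩
  have hconj : (R g).trace = (R (rep5 (cls5 g))).trace := by
    obtain ⟨h, e⟩ := cls5_conj g
    have : g = h⁻¹ * (rep5 (cls5 g) * h) := by rw [← e]; group
    conv_lhs => rw [this]
    rw [map_mul, Matrix.trace_mul_comm, ← map_mul]
    simp [mul_assoc]
  rw [htr, hconj]
  have hTT' : (R (gT * gT)).trace = -1 - (R gT).trace := by
    rw [hTT]; linear_combination hT
  generalize cls5 g = i
  have hz : ∀ x, (R (gZ * x)).trace = -(R x).trace := by
    intro x; rw [map_mul, hZ]; simp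
  fin_cases i
  · simp [rep5, row5]
  · simp [rep5, row5, hZ]
  · simpa [rep5, row5] using hS
  · exact hU
  · exact (hz _).trans (by rw [hU]; rfl)
  · rfl
  · exact hTT'
  · exact hz _
  · exact (hz _).trans (by rw [hTT']; simp [row5]; ring)

theorem irr5 (ρ : Representation ℂ G5 (Fin 2 → ℂ))
    (hirr : ∀ p : Submodule ℂ (Fin 2 → ℂ), (∀ g, ∀ v ∈ p, ρ g v ∈ p) → p = ⊥ ∨ p = ⊤) :
    ρ.IsIrreducible := by
  have : Nontrivial (Subrepresentation ρ) := by
    refine ⟨⊥, ⊤, fun h => ?_⟩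
    have h2 : (⊥ : Submodule ℂ (Fin 2 → ℂ)) = ⊤ := congrArg Subrepresentation.toSubmodule h
    exact bot_ne_top h2
  refine IsSimpleOrder.mk fun p => ?_
  rcases hirr p.toSubmodule (fun g v hv => p.apply_mem_toSubmodule g hv) with h | h
  · left; exact Subrepresentation.toSubmodule_injective h
  · right; exact Subrepresentation.toSubmodule_injective h

theorem conj5 (t : ℂ) (h : t ^ 2 + t - 1 = 0) : (starRingEnd ℂ) t = t := by
  rw [Complex.conj_eq_iff_im]
  have h1 := congrArg Complex.re h
  have h2 := congrArg Complex.im h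
  simp [pow_two] at h1 h2
  by_contra hy
  have : 2 * t.re + 1 = 0 := by
    apply mul_right_cancel₀ hy
    linear_combination h2
  have hx : t.re = -1 / 2 := by linarith
  rw [hx] at h1
  nlinarith [sq_nonneg t.im]

/-- Let `G = SL(2, 𝔽₅)` and let `f`, `lam` be the characters of two
non-isomorphic irreducible 2-dimensional complex representations of `G`.  Then
`⟨lam, f^n⟩ = 0` for `1 ≤ n ≤ 6` and `⟨lam, f⁷⟩ = 1`: `lam` occurs in the 7-th tensor power
of `f` with multiplicity exactly one and does not occur in any lower tensor power. -/
theorem sl2f5_lam_multiplicity_in_f_pows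
    (ρf ρl : Representation ℂ (Matrix.SpecialLinearGroup (Fin 2) (ZMod 5)) (Fin 2 → ℂ))
    (hfirr : ∀ p : Submodule ℂ (Fin 2 → ℂ),
      (∀ g, ∀ v ∈ p, ρf g v ∈ p) → p = ⊥ ∨ p = ⊤)
    (hlirr : ∀ p : Submodule ℂ (Fin 2 → ℂ),
      (∀ g, ∀ v ∈ p, ρl g v ∈ p) → p = ⊥ ∨ p = ⊤)
    (hnoniso : ¬ ∃ e : (Fin 2 → ℂ) ≃ₗ[ℂ] (Fin 2 → ℂ),
      ∀ g v, e (ρf g v) = ρl g (e v))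
    (f lam : Matrix.SpecialLinearGroup (Fin 2) (ZMod 5) → ℂ)
    (hf : ∀ g, f g = LinearMap.trace ℂ (Fin 2 → ℂ) (ρf g))
    (hlam : ∀ g, lam g = LinearMap.trace ℂ (Fin 2 → ℂ) (ρl g)) :
    (∀ n : ℕ, 1 ≤ n → n ≤ 6 → innerChar _ lam (fun g => f g ^ n) = 0) ∧
    innerChar _ lam (fun g => f g ^ 7) = 1 := by
  obtain ⟨t, ht, hft⟩ := char5 ρf hfirr
  obtain ⟨s, hs, hls⟩ := char5 ρl hlirr
  have hst : s ≠ t := by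
    intro h
    subst h
    have := irr5 ρf hfirr
    have := irr5 ρl hlirr
    have hinv : Invertible (Nat.card G5 : ℂ) := by
      apply invertibleOfNonzero
      rw [Nat.card_eq_fintype_card, card5]; norm_num
    have hc : ρl.character = ρf.character := by
      funext g
      exact (hls g).trans (hft g).symm
    have h1 := Representation.char_orthonormal ρf ρf
    have h2 := Representation.char_orthonormal ρl ρf
    rw [hc, h1, if_pos ⟨Representation.Equiv.refl ρf⟩] at h2
    split_ifs at h2 with h3
    · obtain ⟨e⟩ := h3
      exact hnoniso ⟨e.toLinearEquiv, fun g v => e.toIntertwiningMap.isIntertwining _ _ g v⟩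
    · exact one_ne_zero h2
  have hs' : s = -1 - t := by
    have : (s - t) * (s + t + 1) = 0 := by linear_combination hs - ht
    rcases mul_eq_zero.mp this with h | h
    · exact absurd (sub_eq_zero.mp h) hst
    · linear_combination h
  have hct := conj5 t ht
  have key : ∀ n : ℕ, innerChar _ lam (fun g => f g ^ n) = (120 : ℂ)⁻¹ *
      (2 * 2 ^ n - 2 * (-2) ^ n + 20 - 20 * (-1) ^ n + 12 * ((-1 - t) * t ^ n)
        + 12 * (t * (-1 - t) ^ n) + 12 * ((1 + t) * (-t) ^ n) - 12 * (t * (1 + t) ^ n)) := by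
    intro n
    have e : ∀ g, (starRingEnd ℂ) (lam g) * f g ^ n =
        (fun i => (starRingEnd ℂ) (row5 s i) * row5 t i ^ n) (cls5 g) := by
      intro g; rw [hf, hlam, hft, hls]
    unfold innerChar
    simp only [e]
    rw [sum5 (fun i => (starRingEnd ℂ) (row5 s i) * row5 t i ^ n), card5, hs']
    have hc2 : (starRingEnd ℂ) (2 : ℂ) = 2 := Complex.conj_ofNat 2
    simp [row5, hct, hc2]
    ring
  have h2 : t ^ 2 = 1 - t := by linear_combination ht
  have h3 : t ^ 3 = 2 * t - 1 := by linear_combination (t - 1) * ht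
  have h4 : t ^ 4 = 2 - 3 * t := by linear_combination (t ^ 2 - t + 2) * ht
  have h5 : t ^ 5 = 5 * t - 3 := by linear_combination t * h4 - 3 * h2
  have h6 : t ^ 6 = 5 - 8 * t := by linear_combination t * h5 + 5 * h2
  have h7 : t ^ 7 = 13 * t - 8 := by linear_combination t * h6 - 8 * h2
  have h8 : t ^ 8 = 13 - 21 * t := by linear_combination t * h7 + 13 * h2
  refine ⟨fun n h1 hn => ?_, ?_⟩
  · rw [key]
    interval_cases n <;> ring_nf <;> simp only [h2, h3, h4, h5, h6, h7, h8] <;> ring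
  · rw [key]
    ring_nf
    simp only [h2, h3, h4, h5, h6, h7, h8]
    ring
end

section
/- Let G = SL(2, 𝔽₅) and let f and λ be the characters of two non-isomorphic irreducible 2-dimensional complex representations of G. Then ⟨λ, f^n⟩ = 0 whenever n is even, ⟨λ, f^n⟩ > 0 for every odd n ≥ 7, and ⟨λ, f⁹⟩ = 8. -/
instance fact5 : Fact (Nat.Prime 5) := ⟨by norm_num⟩
abbrev GG := Matrix.SpecialLinearGroup (Fin 2) (ZMod 5)
def sS : GG := ⟨!![0,-1;1,0], by decide⟩
def sT : GG := ⟨!![1,1;0,1], by decide⟩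
def sU (x : ZMod 5) : GG := ⟨!![1,x;0,1], by simp⟩

lemma sS_val : sS.1 = !![0,-1;1,0] := rfl
lemma sU_val (x : ZMod 5) : (sU x).1 = !![1,x;0,1] := rfl
def mk4 (a b c d : ZMod 5) (h : a * d - b * c = 1) : GG := ⟨!![a,b;c,d], by simpa [Matrix.det_fin_two] using h⟩
lemma mk4_val (a b c d : ZMod 5) (h : a * d - b * c = 1) : (mk4 a b c d h).1 = !![a,b;c,d] := rfl

def clsE (a b c d : ZMod 5) : Fin 9 :=
  if a + d = 0 then 2 else if a + d = 1 then 3 else if a + d = -1 then 4 else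
  if a + d = 2 then
    (if b = 0 ∧ c = 0 then 0 else if b = 1 ∨ b = -1 ∨ c = 1 ∨ c = -1 then 5 else 6)
  else
    (if b = 0 ∧ c = 0 then 1 else if b = 1 ∨ b = -1 ∨ c = 1 ∨ c = -1 then 7 else 8)
/-- class index -/
def cls (g : GG) : Fin 9 := clsE (g.1 0 0) (g.1 0 1) (g.1 1 0) (g.1 1 1)
def rep : Fin 9 → GG := ![1, sS^2, sS, sS*sT, sS^3*sT, sT, sT^2, sS^2*sT, sS^2*sT^2]
/-- value of the form `det (v, g v)` used to normalise the class -/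
def ctab : Fin 9 → ZMod 5 := ![0,0,1,1,1,1,2,1,2]
def trtab : Fin 9 → ZMod 5 := ![2,-2,0,1,-1,2,2,-2,-2]
set_option maxRecDepth 100000
lemma cards : ∀ k, (Finset.univ.filter (fun g : GG => cls g = k)).card = ![1,1,30,20,20,12,12,12,12] k := by
  decide +kernel
lemma clsE_spec1 : ∀ a b c d : ZMod 5, a * d - b * c = 1 → a + d = trtab (clsE a b c d) := by
  decide +kernel
lemma clsE_spec2 : ∀ a b c d : ZMod 5, a * d - b * c = 1 →
    ctab (clsE a b c d) = 0 →
    ((clsE a b c d = 0 ∧ a = 1 ∧ b = 0 ∧ c = 0 ∧ d = 1) ∨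
     (clsE a b c d = 1 ∧ a = -1 ∧ b = 0 ∧ c = 0 ∧ d = -1)) := by
  decide +kernel
lemma clsE_spec3 : ∀ a b c d : ZMod 5, a * d - b * c = 1 → ctab (clsE a b c d) ≠ 0 →
    ∃ p q : ZMod 5, p * (c * p + d * q) - q * (a * p + b * q) = ctab (clsE a b c d) := by
  decide +kernel
lemma rep_cls : ∀ k, cls (rep k) = k := by decide +kernel
lemma sU_eq : ∀ x, sU x = sT ^ x.val := by decide +kernel
lemma rels : sS^4 = 1 ∧ sT^5 = 1 ∧ (sS * sT)^3 = sS^2 := by decide +kernel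
lemma s3 : sS^3 = sS⁻¹ := by decide +kernel
lemma gen : ∀ g : GG, g ∈ Submonoid.closure ({sS, sT} : Set GG) := by
  have hS : sS ∈ Submonoid.closure ({sS, sT} : Set GG) := Submonoid.subset_closure (by simp)
  have hU : ∀ x, sU x ∈ Submonoid.closure ({sS, sT} : Set GG) := fun x => by
    rw [sU_eq]; exact Submonoid.pow_mem _ (Submonoid.subset_closure (by simp)) _
  have key : ∀ g : GG, g.1 1 0 ≠ 0 → g ∈ Submonoid.closure ({sS, sT} : Set GG) := by
    intro g hc
    have hd := g.2
    rw [Matrix.det_fin_two] at hd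
    have : g = sU ((g.1 0 0 + 1)/g.1 1 0) * sS * sU (g.1 1 0 + 1) * sS * sU 1 * sS *
        sU ((g.1 1 1 + g.1 1 0 + 1)/g.1 1 0) := by
      ext i j
      generalize ha : g.1 0 0 = a at *
      generalize hb : g.1 0 1 = b at *
      generalize hc' : g.1 1 0 = c at *
      generalize hd' : g.1 1 1 = d at *
      fin_cases i <;> fin_cases j <;>
        simp [Matrix.SpecialLinearGroup.coe_mul, sU_val, sS_val, Matrix.mul_apply, Fin.sum_univ_two, ha, hb, hc', hd'] <;> field_simp <;>
        grind
    rw [this]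
    repeat' apply Submonoid.mul_mem
    all_goals first | exact hS | exact hU _
  intro g
  by_cases hc : g.1 1 0 = 0
  · have h2 : g = sS^3 * (sS * g) := by rw [s3]; group
    rw [h2]
    refine Submonoid.mul_mem _ (Submonoid.pow_mem _ hS _) (key _ ?_)
    have hd := g.2
    rw [Matrix.det_fin_two, hc] at hd
    simp [Matrix.SpecialLinearGroup.coe_mul, sS_val, Matrix.mul_apply, Fin.sum_univ_two]
    intro h
    simp [h] at hd
  · exact key g hc

/-- `[v, g v / c]` conjugates `g` to a companion-like matrix. -/
lemma conj_comp (g g' : GG) (htr : g.1 0 0 + g.1 1 1 = g'.1 0 0 + g'.1 1 1) (c0 : ZMod 5) (h0 : c0 ≠ 0)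
    (h : ∃ p q : ZMod 5, p * (g.1 1 0 * p + g.1 1 1 * q) - q * (g.1 0 0 * p + g.1 0 1 * q) = c0)
    (h' : ∃ p q : ZMod 5, p * (g'.1 1 0 * p + g'.1 1 1 * q) - q * (g'.1 0 0 * p + g'.1 0 1 * q) = c0) :
    IsConj g g' := by
  have main : ∀ g : GG, (∃ p q : ZMod 5, p * (g.1 1 0 * p + g.1 1 1 * q) - q * (g.1 0 0 * p + g.1 0 1 * q) = c0) →
      IsConj (mk4 0 (-1/c0) c0 (g.1 0 0 + g.1 1 1) (by field_simp; ring)) g := by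
    rintro g ⟨p, q, h⟩
    have hd := g.2
    rw [Matrix.det_fin_two] at hd
    rw [isConj_iff]
    refine ⟨mk4 p ((g.1 0 0 * p + g.1 0 1 * q)/c0) q ((g.1 1 0 * p + g.1 1 1 * q)/c0) ?_, ?_⟩
    · field_simp; linear_combination h
    · rw [mul_inv_eq_iff_eq_mul]
      ext i j
      generalize ha : g.1 0 0 = a at *
      generalize hb : g.1 0 1 = b at *
      generalize hc' : g.1 1 0 = c at *
      generalize hd' : g.1 1 1 = d at *
      fin_cases i <;> fin_cases j <;>
        simp [Matrix.SpecialLinearGroup.coe_mul, mk4_val, Matrix.mul_apply, Fin.sum_univ_two, ha, hb, hc', hd'] <;> field_simp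
      · linear_combination p * hd
      · linear_combination q * hd
  have a1 := main g h
  have a2 := main g' h'
  simp only [htr] at a1
  exact a1.symm.trans a2

lemma conj_rep (g : GG) : IsConj g (rep (cls g)) := by
  have key : ∀ g : GG, g.1 0 0 + g.1 1 1 = trtab (cls g) ∧ 
     (g = rep (cls g) ∨ (ctab (cls g) ≠ 0 ∧ ∃ p q : ZMod 5, p * (g.1 1 0 * p + g.1 1 1 * q) - q * (g.1 0 0 * p + g.1 0 1 * q) = ctab (cls g))) := by
    intro g
    have hd := g.2
    rw [Matrix.det_fin_two] at hd
    refine ⟨clsE_spec1 _ _ _ _ hd, ?_⟩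
    by_cases h0 : ctab (cls g) = 0
    swap
    · exact Or.inr (And.intro h0 (clsE_spec3 _ _ _ _ hd h0))
    rcases clsE_spec2 _ _ _ _ hd h0 with ⟨h, ha, hb, hc, hd⟩ | ⟨h, ha, hb, hc, hd⟩
    · left
      rw [cls, h]
      ext i j
      fin_cases i <;> fin_cases j <;> simp [rep, ha, hb, hc, hd]
    · left
      rw [cls, h]
      have : rep 1 = mk4 (-1) 0 0 (-1) (by decide) := by decide +kernel
      rw [this]
      ext i j
      fin_cases i <;> fin_cases j <;> simp [mk4_val, ha, hb, hc, hd]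
  obtain ⟨h1, h2⟩ := key g
  obtain ⟨h1', h2'⟩ := key (rep (cls g))
  rw [rep_cls] at h1' h2'
  rcases h2 with h2 | ⟨h0, h2⟩
  · rw [← h2]
  · rcases h2' with h2' | ⟨-, h2'⟩
    · have : ∀ k, ctab k ≠ 0 → ∃ p q : ZMod 5, p * ((rep k).1 1 0 * p + (rep k).1 1 1 * q) - q * ((rep k).1 0 0 * p + (rep k).1 0 1 * q) = ctab k := by decide +kernel
      exact conj_comp _ _ (h1.trans h1'.symm) _ h0 h2 (this _ h0)
    · exact conj_comp _ _ (h1.trans h1'.symm) _ h0 h2 h2'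

lemma cayley2 (M : Matrix (Fin 2) (Fin 2) ℂ) (h : M.det = 1) : M * M = M.trace • M - 1 := by
  rw [Matrix.det_fin_two] at h
  ext i j
  fin_cases i <;> fin_cases j <;>
    simp [Matrix.mul_apply, Matrix.trace_fin_two, Fin.sum_univ_two] <;> grind

lemma exists_eig (M : Matrix (Fin 2) (Fin 2) ℂ) : ∃ v : Fin 2 → ℂ, v ≠ 0 ∧ ∃ c : ℂ, M.mulVec v = c • v := by
  obtain ⟨c, hc⟩ := Module.End.exists_eigenvalue (Matrix.toLin' M)
  obtain ⟨v, hv⟩ := hc.exists_hasEigenvector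
  exact ⟨v, hv.2, c, by simpa using hv.apply_eq_smul⟩

lemma scal_of {p q : ℂ} {M : Matrix (Fin 2) (Fin 2) ℂ} (hp : p ≠ 0) (h : p • M = q • 1) :
    M = (q / p) • (1 : Matrix (Fin 2) (Fin 2) ℂ) := by
  rw [div_eq_inv_mul, mul_smul, ← h, smul_smul, inv_mul_cancel₀ hp, one_smul]

def vals (t : ℂ) : Fin 9 → ℂ := ![2, -2, 0, 1, -1, t, -1 - t, -t, 1 + t]

lemma char_vals (ρ : Representation ℂ GG (Fin 2 → ℂ))
    (hirr : ∀ p : Submodule ℂ (Fin 2 → ℂ), (∀ g, ∀ v ∈ p, ρ g v ∈ p) → p = ⊥ ∨ p = ⊤) :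
    ∃ t : ℂ, t ^ 2 + t = 1 ∧ ∀ g, LinearMap.trace ℂ (Fin 2 → ℂ) (ρ g) = vals t (cls g) := by
  -- no common eigenvector
  have hno : ∀ v : Fin 2 → ℂ, v ≠ 0 → (∃ c : ℂ, ρ sS v = c • v) → (∃ c : ℂ, ρ sT v = c • v) → False := by
    intro v hv hS hT
    have hall : ∀ g, ∃ c : ℂ, ρ g v = c • v := by
      intro g
      induction gen g using Submonoid.closure_induction with
      | mem x hx => rcases hx with rfl | rfl <;> assumption
      | one => exact ⟨1, by simp⟩
      | mul x y _ _ hx hy =>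
        obtain ⟨c, hc⟩ := hx
        obtain ⟨d, hd⟩ := hy
        exact ⟨d * c, by rw [map_mul, Module.End.mul_apply, hd, map_smul, hc, smul_smul]⟩
    rcases hirr (Submodule.span ℂ {v}) (by
      intro g w hw
      obtain ⟨a, rfl⟩ := Submodule.mem_span_singleton.1 hw
      obtain ⟨c, hc⟩ := hall g
      rw [map_smul, hc]
      exact Submodule.smul_mem _ _ (Submodule.smul_mem _ _ (Submodule.mem_span_singleton_self v))) with h | h
    · exact hv (Submodule.span_singleton_eq_bot.1 h)
    · have h1 := finrank_span_singleton (K := ℂ) hv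
      rw [h, finrank_top] at h1
      simp at h1
  -- pass to matrices
  obtain ⟨R, hR⟩ : ∃ R : GG →* Matrix (Fin 2) (Fin 2) ℂ, ∀ g, R g = LinearMap.toMatrix' (ρ g) :=
    ⟨(LinearMap.toMatrixAlgEquiv' (R := ℂ) (n := Fin 2) : _ →* _).comp ρ, fun g => rfl⟩
  have hRv : ∀ g v, (R g).mulVec v = ρ g v := fun g v => by
    rw [hR, LinearMap.toMatrix'_mulVec]
  have htr : ∀ g, LinearMap.trace ℂ (Fin 2 → ℂ) (ρ g) = (R g).trace := fun g => by
    rw [hR, LinearMap.trace_eq_matrix_trace ℂ (Pi.basisFun ℂ (Fin 2))]; rfl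
  have hno2 : ∀ v : Fin 2 → ℂ, v ≠ 0 → (∃ c : ℂ, (R sS).mulVec v = c • v) →
      (∃ c : ℂ, (R sT).mulVec v = c • v) → False := by
    intro v hv h1 h2
    simp only [hRv] at h1 h2
    exact hno v hv h1 h2
  obtain ⟨rS, rT, rST⟩ := rels
  have eS : R sS ^ 4 = 1 := by rw [← map_pow, rS, map_one]
  have eT : R sT ^ 5 = 1 := by rw [← map_pow, rT, map_one]
  have eST : (R sS * R sT) ^ 3 = R sS ^ 2 := by rw [← map_mul, ← map_pow, rST, map_pow]
  have dS4 : (R sS).det ^ 4 = 1 := by rw [← Matrix.det_pow, eS, Matrix.det_one]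
  have dT5 : (R sT).det ^ 5 = 1 := by rw [← Matrix.det_pow, eT, Matrix.det_one]
  have dST : ((R sS).det * (R sT).det) ^ 3 = (R sS).det ^ 2 := by
    rw [← Matrix.det_mul, ← Matrix.det_pow, eST, Matrix.det_pow]
  have hdT0 : (R sT).det ≠ 0 := fun h => by simp [h] at dT5
  have hdS0 : (R sS).det ≠ 0 := fun h => by simp [h] at dS4
  have d1 : (R sS).det * (R sT).det ^ 3 = 1 := by
    apply mul_left_cancel₀ (pow_ne_zero 2 hdS0)
    linear_combination dST
  have dT : (R sT).det = 1 := by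
    have : (R sT).det ^ 12 = 1 := by
      have h4 : ((R sS).det * (R sT).det ^ 3) ^ 4 = 1 := by rw [d1]; simp
      rw [mul_pow, dS4] at h4
      linear_combination h4
    generalize (R sT).det = x at *
    have h10 : x ^ 10 = 1 := by linear_combination (x^5 + 1) * dT5
    have h2 : x ^ 2 = 1 := by linear_combination this - x ^ 2 * h10
    linear_combination dT5 - (x^3 + x) * h2
  have dS : (R sS).det = 1 := by simpa [dT] using d1
  clear d1 dST dT5 dS4
  generalize hA : R sS = A at *
  generalize hB : R sT = B at *
  have cA := cayley2 A dS
  have cB := cayley2 B dT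
  have cM := cayley2 (A * B) (by rw [Matrix.det_mul, dS, dT, one_mul])
  have nA : ∀ c : ℂ, A ≠ c • 1 := by
    intro c hc
    obtain ⟨v, hv, hv'⟩ := exists_eig B
    exact hno2 v hv ⟨c, by simp [hc, Matrix.smul_mulVec]⟩ hv'
  have nB : ∀ c : ℂ, B ≠ c • 1 := by
    intro c hc
    obtain ⟨v, hv, hv'⟩ := exists_eig A
    exact hno2 v hv hv' ⟨c, by simp [hc, Matrix.smul_mulVec]⟩
  have tA : A.trace = 0 := by
    generalize A.trace = a at *
    by_contra h0
    have h4 : A ^ 4 = (a ^ 3 - 2 * a) • A - (a ^ 2 - 1) • 1 := by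
      calc A ^ 4 = (A * A) * (A * A) := by noncomm_ring
        _ = (a • A - 1) * (a • A - 1) := by rw [cA]
        _ = (a ^ 2) • (A * A) - (2 * a) • A + 1 := by
          simp only [sub_mul, mul_sub, smul_mul_assoc, mul_smul_comm, one_mul, mul_one, smul_smul]
          module
        _ = _ := by rw [cA]; module
    rw [eS] at h4
    have h5 : (a ^ 3 - 2 * a) • A = (a ^ 2) • (1 : Matrix (Fin 2) (Fin 2) ℂ) := by
      linear_combination (norm := module) -h4
    by_cases hp : a ^ 3 - 2 * a = 0
    · rw [hp, zero_smul] at h5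
      have := congrFun (congrFun h5 0) 0
      simp at this
      exact h0 (pow_eq_zero_iff two_ne_zero |>.1 this.symm)
    · exact nA _ (scal_of hp h5)
  have A2 : A * A = -1 := by rw [cA, tA]; simp
  have tB : B.trace ^ 2 + B.trace = 1 := by
    generalize B.trace = b at *
    have h5 : B ^ 5 = (b ^ 4 - 3 * b ^ 2 + 1) • B - (b ^ 3 - 2 * b) • 1 := by
      calc B ^ 5 = (B * B) * (B * B) * B := by noncomm_ring
        _ = (b • B - 1) * (b • B - 1) * B := by rw [cB]
        _ = (b ^ 2) • ((B * B) * B) - (2 * b) • (B * B) + B := by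
          simp only [sub_mul, mul_sub, smul_mul_assoc, mul_smul_comm, one_mul, mul_one, smul_smul]
          module
        _ = (b ^ 3 - 2 * b) • (B * B) + (1 - b ^ 2) • B + (2 * b - 2 * b) • 1:= by
          rw [cB]
          simp only [sub_mul, smul_mul_assoc, one_mul]
          rw [cB]
          module
        _ = _ := by rw [cB]; module
    rw [eT] at h5
    have h6 : (b ^ 4 - 3 * b ^ 2 + 1) • B = (b ^ 3 - 2 * b + 1) • (1 : Matrix (Fin 2) (Fin 2) ℂ) := by
      linear_combination (norm := module) -h5
    by_cases hp : b ^ 4 - 3 * b ^ 2 + 1 = 0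
    · rw [hp, zero_smul] at h6
      have := congrFun (congrFun h6 0) 0
      simp at this
      linear_combination -hp - b * this
    · exact (nB _ (scal_of hp h6)).elim
  have tM : (A * B).trace = 1 := by
    have hM3 : (A * B) ^ 3 = -1 := by rw [eST, pow_two, A2]
    have nM : ∀ c : ℂ, A * B ≠ c • 1 := by
      intro c hc
      have hB' : B = (-c) • A := by
        calc B = -(A * A * B) := by rw [A2]; simp
          _ = -(A * (A * B)) := by rw [mul_assoc]
          _ = _ := by rw [hc]; simp
      obtain ⟨v, hv, x, hx⟩ := exists_eig A
      exact hno2 v hv ⟨x, hx⟩ ⟨-c * x, by rw [hB', Matrix.smul_mulVec, hx, smul_smul]⟩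
    generalize A * B = M at *
    generalize M.trace = m at *
    have h3 : M ^ 3 = (m ^ 2 - 1) • M - m • 1 := by
      calc M ^ 3 = (M * M) * M := by noncomm_ring
        _ = m • (M * M) - M := by rw [cM]; simp only [sub_mul, smul_mul_assoc, one_mul]; rw [cM]
        _ = _ := by rw [cM]; module
    rw [hM3] at h3
    have h6 : (m ^ 2 - 1) • M = (m - 1) • (1 : Matrix (Fin 2) (Fin 2) ℂ) := by
      linear_combination (norm := module) -h3
    by_cases hp : m ^ 2 - 1 = 0
    · rw [hp, zero_smul] at h6
      have := congrFun (congrFun h6 0) 0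
      simp at this
      linear_combination -this
    · exact (nM _ (scal_of hp h6)).elim
  have tB2 : (B * B).trace = -1 - B.trace := by
    rw [cB]; simp [Matrix.trace_sub, Matrix.trace_smul]; linear_combination tB
  refine ⟨B.trace, tB, fun g => ?_⟩
  have hconj : (R g).trace = (R (rep (cls g))).trace := by
    obtain ⟨h, hh⟩ := isConj_iff.1 (conj_rep g)
    rw [← hh, map_mul, Matrix.trace_mul_comm, ← map_mul]
    congr 2; group
  rw [htr, hconj]
  generalize cls g = k
  fin_cases k
  · simp [rep, vals]
  · simp [rep, vals, hA, pow_two, A2]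
  · simp [rep, vals, hA, tA]
  · simp [rep, vals, hA, hB, tM]
  · simp [rep, vals, hA, hB, tM, pow_succ, A2]
  · simp [rep, vals, hB]
  · simp [rep, vals, hB, pow_two, tB2]
  · simp [rep, vals, hA, hB, pow_two, A2]
  · simp [rep, vals, hA, hB, pow_two, A2, tB2, add_comm]

lemma sum_cls (F : Fin 9 → ℂ) : ∑ g : GG, F (cls g) =
    F 0 + F 1 + 30 * F 2 + 20 * F 3 + 20 * F 4 + 12 * F 5 + 12 * F 6 + 12 * F 7 + 12 * F 8 := by
  rw [← Finset.sum_fiberwise (s := Finset.univ) (g := cls)]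
  have : ∀ k, ∑ g ∈ Finset.univ.filter (fun g : GG => cls g = k), F (cls g) =
      ((![1,1,30,20,20,12,12,12,12] k : ℕ) : ℂ) * F k := by
    intro k
    rw [← cards k, Finset.sum_congr rfl (g := fun _ => F k), Finset.sum_const, nsmul_eq_mul]
    intro g hg
    rw [(Finset.mem_filter.1 hg).2]
  simp only [this, Fin.sum_univ_succ]
  simp
  ring

lemma cardG : (Fintype.card GG : ℂ) = 120 := by
  have := sum_cls (fun _ => 1)
  simp at this
  rw [this]; norm_num

lemma real_t {t : ℂ} (h : t ^ 2 + t = 1) : (starRingEnd ℂ) t = t := by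
  have h5 : ((Real.sqrt 5 : ℝ) : ℂ) ^ 2 = 5 := by
    rw [← Complex.ofReal_pow, Real.sq_sqrt (by norm_num)]; norm_num
  have : (t - (((-1 + Real.sqrt 5) / 2 : ℝ) : ℂ)) * (t - (((-1 - Real.sqrt 5) / 2 : ℝ) : ℂ)) = 0 := by
    push_cast
    linear_combination h - h5 / 4
  rcases mul_eq_zero.1 this with h | h
  all_goals rw [sub_eq_zero.1 h]; exact Complex.conj_ofReal _

/-- The multiplicities: `seqm k` is the multiplicity for `n = 2 k + 7`. -/
lemma exists_seq {t s : ℂ} (h : t ^ 2 + t = 1) (hs : s = -1 - t) (k : ℕ) :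
    ∃ m m' : ℤ, 0 < m ∧ m ≤ m' ∧
      (15 : ℂ) * m = 4 ^ (k + 3) + 5 - 3 * (t ^ (2 * k + 6) + s ^ (2 * k + 6)) ∧
      (15 : ℂ) * m' = 4 ^ (k + 4) + 5 - 3 * (t ^ (2 * k + 8) + s ^ (2 * k + 8)) := by
  have hs2 : s ^ 2 + s = 1 := by rw [hs]; linear_combination h
  have t4 : t ^ 4 = 3 * t ^ 2 - 1 := by linear_combination (t ^ 2 - t - 1) * h
  have s4 : s ^ 4 = 3 * s ^ 2 - 1 := by linear_combination (s ^ 2 - s - 1) * hs2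
  have geo : ∀ k : ℕ, ∃ c : ℤ, 0 ≤ c ∧ 3 * c = 4 ^ k - 1 := by
    intro k
    induction k with
    | zero => exact ⟨0, by simp⟩
    | succ k ih =>
      obtain ⟨c, hc, hc'⟩ := ih
      exact ⟨4 * c + 1, by omega, by rw [pow_succ]; linarith⟩
  induction k with
  | zero =>
    refine ⟨1, 8, by norm_num, by norm_num, ?_, ?_⟩
    · have a1 : t ^ 6 = 8 * t ^ 2 - 3 := by linear_combination (t ^ 2 + 3) * t4
      have a2 : s ^ 6 = 8 * s ^ 2 - 3 := by linear_combination (s ^ 2 + 3) * s4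
      norm_num [a1, a2]
      rw [hs]
      linear_combination 48 * h
    · have a1 : t ^ 8 = 21 * t ^ 2 - 8 := by linear_combination (t ^ 4 + 3 * t ^ 2 + 8) * t4
      have a2 : s ^ 8 = 21 * s ^ 2 - 8 := by linear_combination (s ^ 4 + 3 * s ^ 2 + 8) * s4
      norm_num [a1, a2]
      rw [hs]
      linear_combination 126 * h
  | succ k ih =>
    obtain ⟨m, m', h0, h1, e1, e2⟩ := ih
    obtain ⟨c, hc, hc'⟩ := geo (k + 3)
    have hcc : (3 : ℂ) * c = 4 ^ (k + 3) - 1 := by exact_mod_cast hc'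
    refine ⟨m', 3 * m' - m + c, by omega, by omega, ?_, ?_⟩
    · rw [e2]; ring
    · push_cast
      have : (15 : ℂ) * (3 * m' - m + c) = 3 * (15 * m') - 15 * m + 5 * (3 * c) := by ring
      rw [this, e1, e2, hcc]
      linear_combination (-3 * t ^ (2 * k + 6)) * (-t4) + (-3 * s ^ (2 * k + 6)) * (-s4)

open Representation in
lemma iso_of_char (ρ σ : Representation ℂ GG (Fin 2 → ℂ))
    (h1 : ∀ p : Submodule ℂ (Fin 2 → ℂ), (∀ g, ∀ v ∈ p, ρ g v ∈ p) → p = ⊥ ∨ p = ⊤)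
    (h2 : ∀ p : Submodule ℂ (Fin 2 → ℂ), (∀ g, ∀ v ∈ p, σ g v ∈ p) → p = ⊥ ∨ p = ⊤)
    (h : ∀ g, LinearMap.trace ℂ (Fin 2 → ℂ) (ρ g) = LinearMap.trace ℂ (Fin 2 → ℂ) (σ g)) :
    ∃ e : (Fin 2 → ℂ) ≃ₗ[ℂ] (Fin 2 → ℂ), ∀ g v, e (ρ g v) = σ g (e v) := by
  have irr : ∀ τ : Representation ℂ GG (Fin 2 → ℂ),
      (∀ p : Submodule ℂ (Fin 2 → ℂ), (∀ g, ∀ v ∈ p, τ g v ∈ p) → p = ⊥ ∨ p = ⊤) →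
      IsIrreducible τ := by
    intro τ hτ
    have : Nontrivial (Subrepresentation τ) := by
      refine ⟨⊥, ⊤, fun h => ?_⟩
      have := congrArg Subrepresentation.toSubmodule h
      exact bot_ne_top (α := Submodule ℂ (Fin 2 → ℂ)) this
    refine ⟨fun p => ?_⟩
    rcases hτ p.toSubmodule (fun g v hv => p.apply_mem_toSubmodule g hv) with h | h
    · left; exact Subrepresentation.toSubmodule_injective h
    · right; exact Subrepresentation.toSubmodule_injective h
  have := irr ρ h1
  have := irr σ h2
  have hc : (Nat.card GG : ℂ) ≠ 0 := by simp
  let _ : Invertible (Nat.card GG : ℂ) := invertibleOfNonzero hc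
  have hch : ρ.character = σ.character := funext h
  have e1 := char_orthonormal ρ ρ
  have e2 := char_orthonormal σ ρ
  rw [← hch, e1] at e2
  rw [if_pos ⟨Representation.Equiv.refl ρ⟩] at e2
  by_cases hne : Nonempty (Representation.Equiv ρ σ)
  · obtain ⟨φ⟩ := hne
    refine ⟨φ.toLinearEquiv, fun g v => ?_⟩
    exact IntertwiningMap.isIntertwining _ _ φ.toIntertwiningMap g v
  · rw [if_neg hne] at e2
    simp at e2

/-- Let `G = SL(2, 𝔽₅)` and let `f`, `lam` be the characters of two
non-isomorphic irreducible 2-dimensional complex representations of `G`.  Then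
`⟨lam, f^n⟩ = 0` whenever `n` is even, `⟨lam, f^n⟩ > 0` (a positive natural number,
`⟨lam, f^n⟩` being the multiplicity of `lam` in `f^{⊗n}`) for every odd `n ≥ 7`, and
`⟨lam, f⁹⟩ = 8`. -/
theorem sl2f5_lam_multiplicity_parity
    (ρf ρl : Representation ℂ (Matrix.SpecialLinearGroup (Fin 2) (ZMod 5)) (Fin 2 → ℂ))
    (hfirr : ∀ p : Submodule ℂ (Fin 2 → ℂ),
      (∀ g, ∀ v ∈ p, ρf g v ∈ p) → p = ⊥ ∨ p = ⊤)
    (hlirr : ∀ p : Submodule ℂ (Fin 2 → ℂ),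
      (∀ g, ∀ v ∈ p, ρl g v ∈ p) → p = ⊥ ∨ p = ⊤)
    (hnoniso : ¬ ∃ e : (Fin 2 → ℂ) ≃ₗ[ℂ] (Fin 2 → ℂ),
      ∀ g v, e (ρf g v) = ρl g (e v))
    (f lam : Matrix.SpecialLinearGroup (Fin 2) (ZMod 5) → ℂ)
    (hf : ∀ g, f g = LinearMap.trace ℂ (Fin 2 → ℂ) (ρf g))
    (hlam : ∀ g, lam g = LinearMap.trace ℂ (Fin 2 → ℂ) (ρl g)) :
    (∀ n : ℕ, Even n → innerChar _ lam (fun g => f g ^ n) = 0) ∧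
    (∀ n : ℕ, Odd n → 7 ≤ n →
      ∃ m : ℕ, 0 < m ∧ innerChar _ lam (fun g => f g ^ n) = m) ∧
    innerChar _ lam (fun g => f g ^ 9) = 8 := by
  obtain ⟨t, ht, hft⟩ := char_vals ρf hfirr
  obtain ⟨s, hs, hls⟩ := char_vals ρl hlirr
  have hst : s = -1 - t := by
    by_contra hne
    have h0 : (s - t) * (s - (-1 - t)) = 0 := by linear_combination hs - ht
    have hst : s = t := by
      rcases mul_eq_zero.1 h0 with h | h
      · exact sub_eq_zero.1 h
      · exact absurd (sub_eq_zero.1 h) hne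
    exact hnoniso (iso_of_char ρf ρl hfirr hlirr (fun g => by rw [hft, hls, hst]))
  have key : ∀ n : ℕ, innerChar _ lam (fun g => f g ^ n) =
      (120 : ℂ)⁻¹ * ((1 - (-1) ^ n) * (2 * 2 ^ n + 20 + 12 * (s * t ^ n + t * s ^ n))) := by
    intro n
    have h1 : ∀ g, (starRingEnd ℂ) (lam g) * f g ^ n =
        (fun k => (starRingEnd ℂ) (vals s k) * vals t k ^ n) (cls g) := by
      intro g
      simp only [hf, hlam, hft, hls]
    have n1 : ((-2 : ℂ)) ^ n = (-1) ^ n * 2 ^ n := by rw [← mul_pow]; norm_num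
    have n2 : ((-t : ℂ)) ^ n = (-1) ^ n * t ^ n := by rw [← mul_pow]; norm_num
    have n3 : ((1 + t : ℂ)) ^ n = (-1) ^ n * s ^ n := by rw [← mul_pow, hst]; congr 1; ring
    have n4 : (-1 - t : ℂ) ^ n = s ^ n := by rw [hst]
    have n5 : (starRingEnd ℂ) 2 = 2 := map_ofNat _ 2
    have ht' : t = -1 - s := by rw [hst]; ring
    simp only [innerChar]
    rw [cardG, Finset.sum_congr rfl (fun g _ => h1 g),
      sum_cls (fun k => (starRingEnd ℂ) (vals s k) * vals t k ^ n)]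
    simp only [vals]
    simp [real_t hs, n1, n2, n3, n4]
    rw [n5]
    rw [ht']
    ring
  have hst1 : s * t = -1 := by rw [hst]; linear_combination -ht
  have odd_key : ∀ k : ℕ, ∃ m : ℕ, 0 < m ∧ innerChar _ lam (fun g => f g ^ (2 * k + 7)) = m ∧
      (15 : ℂ) * m = 4 ^ (k + 3) + 5 - 3 * (t ^ (2 * k + 6) + s ^ (2 * k + 6)) := by
    intro k
    obtain ⟨m, -, hm, -, e, -⟩ := exists_seq ht hst k
    lift m to ℕ using hm.le
    refine ⟨m, by exact_mod_cast hm, ?_, by exact_mod_cast e⟩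
    rw [key]
    have ho : ((-1 : ℂ)) ^ (2 * k + 7) = -1 := Odd.neg_one_pow ⟨k + 3, by ring⟩
    have h4 : (2 : ℂ) ^ (2 * k + 7) = 2 * 4 ^ (k + 3) := by
      rw [show 2 * k + 7 = 2 * (k + 3) + 1 by ring, pow_succ, pow_mul]; norm_num; ring
    have p1 : s * t ^ (2 * k + 7) = -t ^ (2 * k + 6) := by
      linear_combination t ^ (2 * k + 6) * hst1
    have p2 : t * s ^ (2 * k + 7) = -s ^ (2 * k + 6) := by
      linear_combination s ^ (2 * k + 6) * hst1
    rw [ho, h4, p1, p2]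
    push_cast at e
    linear_combination (-1 / 15 : ℂ) * e
  refine ⟨?_, ?_, ?_⟩
  · intro n hn
    rw [key, hn.neg_one_pow]; simp
  · intro n hn h7
    obtain ⟨j, rfl⟩ := hn
    obtain ⟨k, rfl⟩ : ∃ k, j = k + 3 := ⟨j - 3, by omega⟩
    obtain ⟨m, h0, h1, -⟩ := odd_key k
    exact ⟨m, h0, h1⟩
  · obtain ⟨m, h0, h1, h2⟩ := odd_key 1
    have a1 : t ^ 8 = 21 * t ^ 2 - 8 := by
      linear_combination (t ^ 4 + 3 * t ^ 2 + 8) * (t ^ 2 - t - 1) * ht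
    have a2 : s ^ 8 = 21 * s ^ 2 - 8 := by
      linear_combination (s ^ 4 + 3 * s ^ 2 + 8) * (s ^ 2 - s - 1) * hs
    norm_num [a1, a2] at h2
    rw [show 9 = 2 * 1 + 7 by rfl, h1]
    rw [hst] at h2
    linear_combination (1 / 15 : ℂ) * h2 - (126 / 15 : ℂ) * ht
end

section
/- Let G be a finite perfect group of order 1080 whose center Z has order 3 and such that G/Z is isomorphic to the alternating group A₆ (so G is the triple cover 3.A₆, called Σ(360φ)). Let f and λ be characters of irreducible 3-dimensional complex representations of G such that λ is equal neither to f nor to the complex conjugate character of f. Then ⟨λ·f, λ·f⟩ = 1; that is, the tensor product of the corresponding representations is irreducible. -/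
open Matrix Equiv
theorem pows (A B : Matrix (Fin 3) (Fin 3) ℂ) (hd : A.det = 1) (hAB : A * B = 1) (n : ℕ) (hA : A ^ n = 1) :
    ∃ a b c : ℂ, a^n=1 ∧ b^n=1 ∧ c^n=1 ∧ a*b*c=1 ∧ A.trace = a+b+c ∧ (A^2).trace = a^2+b^2+c^2 ∧ B.trace = a*b+b*c+c*a ∧ (B^2).trace = a^2*b^2+b^2*c^2+c^2*a^2 := by
  have hcard : A.charpoly.roots.card = 3 := by
    rw [← (IsAlgClosed.splits A.charpoly).natDegree_eq_card_roots, A.charpoly_natDegree_eq_dim]; simp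
  obtain ⟨a, b, c, habc⟩ := Multiset.card_eq_three.1 hcard
  have hroot : ∀ x ∈ A.charpoly.roots, x ^ n = 1 := by
    intro x hx
    have h1 : Module.End.HasEigenvalue (Matrix.toLin' A) x := by
      rw [Module.End.hasEigenvalue_iff_isRoot_charpoly, ← LinearMap.charpoly_toMatrix _ (Pi.basisFun ℂ (Fin 3)), LinearMap.toMatrix_eq_toMatrix', LinearMap.toMatrix'_toLin']
      exact Polynomial.isRoot_of_mem_roots hx
    obtain ⟨v, hv⟩ := h1.exists_hasEigenvector
    have := hv.pow_apply n
    rw [← Matrix.toLin'_pow, hA] at this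
    simp at this
    have h2 : (x^n - 1) • v = 0 := by rw [sub_smul, ← this]; simp
    rcases smul_eq_zero.1 h2 with h | h
    · linear_combination h
    · exact absurd h hv.2
  have htr := A.trace_eq_sum_roots_charpoly
  have hdt := A.det_eq_prod_roots_charpoly
  have hprod : A.charpoly = (Polynomial.X - Polynomial.C a) * (Polynomial.X - Polynomial.C b) * (Polynomial.X - Polynomial.C c) := by
    have := (IsAlgClosed.splits A.charpoly).eq_prod_roots_of_monic A.charpoly_monic
    rw [this, habc]; simp [mul_assoc]
  have hev : (1 - A).det = (1-a)*(1-b)*(1-c) := by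
    have := A.eval_charpoly 1
    rw [hprod] at this
    simpa using this.symm
  have hB : B = A.adjugate := by
    have : A.adjugate * A = 1 := by rw [adjugate_mul, hd, one_smul]
    calc B = (A.adjugate * A) * B := by rw [this, one_mul]
      _ = _ := by rw [mul_assoc, hAB, mul_one]
  rw [habc] at htr hdt hroot
  simp at htr hdt hroot
  have hdet : a*b*c = 1 := by rw [mul_assoc, ← hdt, hd]
  have e2 : A.adjugate.trace = a*b+b*c+c*a := by
    have e : (1 - A).det = 1 - A.trace + A.adjugate.trace - A.det := by
      simp [det_fin_three, trace_fin_three, adjugate_fin_three]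
      ring
    rw [e, hd, htr] at hev
    linear_combination hev - hdet
  have hdB : B.det = 1 := by
    have := congrArg Matrix.det hAB
    rwa [det_mul, hd, one_mul, det_one] at this
  have hA' : A = B.adjugate := by
    have : B * B.adjugate = 1 := by rw [mul_adjugate, hdB, one_smul]
    calc A = A * (B * B.adjugate) := by rw [this, mul_one]
      _ = _ := by rw [← mul_assoc, hAB, one_mul]
  have e3 : ∀ A : Matrix (Fin 3) (Fin 3) ℂ, (A^2).trace = A.trace^2 - 2 * A.adjugate.trace := by
    intro A
    simp [trace_fin_three, adjugate_fin_three, pow_two, Matrix.mul_apply, Fin.sum_univ_three]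
    ring
  refine ⟨a, b, c, hroot.1, hroot.2.1, hroot.2.2, hdet, ?_, ?_, ?_, ?_⟩
  · rw [htr]; ring
  · rw [e3, e2, htr]; ring
  · rw [hB, e2]
  · rw [e3, ← hA', hB, e2, htr]; linear_combination (2*(a+b+c)) * hdet
theorem five (a b c : ℂ) (ha : a^5=1) (hb : b^5=1) (hc : a*b*c=1) :
   ((a+b+c)*(a*b+b*c+c*a) + (a^2+b^2+c^2)*(a^2*b^2+b^2*c^2+c^2*a^2) = 3 ∧ a*b+b*c+c*a = a+b+c ∧ (a+b+c)^2 = a+b+c+1 ∧ a^2+b^2+c^2 = 1-(a+b+c)) ∨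
   ((a+b+c)*(a*b+b*c+c*a) + (a^2+b^2+c^2)*(a^2*b^2+b^2*c^2+c^2*a^2) = 8) ∨ 
   ((a+b+c)*(a*b+b*c+c*a) + (a^2+b^2+c^2)*(a^2*b^2+b^2*c^2+c^2*a^2) = 18) := by
  have hz := Complex.isPrimitiveRoot_exp 5 (by norm_num)
  set ζ := Complex.exp (2 * Real.pi * Complex.I / (5:ℕ)) with hζ
  have h5 := hz.pow_eq_one
  have hs : 1 + ζ + ζ^2 + ζ^3 + ζ^4 = 0 := by
    have := hz.geom_sum_eq_zero (by norm_num)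
    simpa [Finset.sum_range_succ] using this
  clear_value ζ
  have hcc : c = a^4*b^4 := by
    have : a^4*b^4*(a*b*c) = c := by linear_combination (b^5*c) * ha + c * hb
    rw [← this, hc, mul_one]
  clear hc
  obtain ⟨i, hi, rfl⟩ := hz.eq_pow_of_pow_eq_one ha
  obtain ⟨j, hj, rfl⟩ := hz.eq_pow_of_pow_eq_one hb
  clear ha hb
  subst hcc
  interval_cases i <;> interval_cases j <;> grind
theorem four (a b c : ℂ) (ha : a^4=1) (hb : b^4=1) (hc : a*b*c=1) :
   (a+b+c=1 ∧ a*b+b*c+c*a = 1) ∨ (a+b+c=-1 ∧ a*b+b*c+c*a = -1 ∧ a^2+b^2+c^2 = 3) ∨ ((a+b+c)*(a*b+b*c+c*a) = 5) ∨ ((a+b+c)*(a*b+b*c+c*a) = 9) := by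
  have h4 : ∀ x : ℂ, x^4=1 → x = 1 ∨ x = -1 ∨ x = Complex.I ∨ x = -Complex.I := by
    intro x hx
    have : (x-1)*((x+1)*((x-Complex.I)*(x+Complex.I))) = 0 := by
      linear_combination hx - (x^2-1) * Complex.I_sq
    simp only [mul_eq_zero] at this
    grind
  have hcc : c = a^3*b^3 := by
    have : a^3*b^3*(a*b*c) = c := by linear_combination (b^4*c) * ha + c * hb
    rw [← this, hc, mul_one]
  subst hcc
  have := Complex.I_sq
  generalize Complex.I = J at *
  clear hc
  rcases h4 a ha with rfl | rfl | rfl | rfl <;> rcases h4 b hb with rfl | rfl | rfl | rfl <;> clear ha hb h4 <;> grind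
theorem two (a b c : ℂ) (ha : a^2=1) (hb : b^2=1) (hc : a*b*c=1) :
   (a+b+c=-1 ∧ a*b+b*c+c*a = -1) ∨ ((a+b+c)*(a*b+b*c+c*a) = 9) := by
  have hcc : c = a*b := by
    have : a*b*(a*b*c) = c := by linear_combination (b^2*c) * ha + c * hb
    rw [← this, hc, mul_one]
  subst hcc
  have h2 : ∀ x : ℂ, x^2=1 → x = 1 ∨ x = -1 := fun x hx => by
    have : (x-1)*(x+1) = 0 := by linear_combination hx
    grind
  rcases h2 a ha with rfl | rfl <;> rcases h2 b hb with rfl | rfl <;> norm_num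
abbrev A6 := alternatingGroup (Fin 6)
def C2 (a : A6) : Prop := (a : Perm (Fin 6)).cycleType = {2,2}
def C4 (a : A6) : Prop := (a : Perm (Fin 6)).cycleType = {4,2}
def C5 (a : A6) : Prop := orderOf a = 5
noncomputable instance decC2 : DecidablePred C2 := Classical.decPred _
noncomputable instance decC4 : DecidablePred C4 := Classical.decPred _
noncomputable instance decC5 : DecidablePred C5 := Classical.decPred _
theorem C2_iff (a : A6) : C2 a ↔ (a : Perm (Fin 6)).cycleType = {2,2} := Iff.rfl
theorem C2.ord {a : A6} (h : C2 a) : orderOf a = 2 := by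
  rw [← Subgroup.orderOf_coe, ← Perm.lcm_cycleType, h]; decide
theorem C4_iff (a : A6) : C4 a ↔ (a : Perm (Fin 6)).cycleType = {4,2} := Iff.rfl
theorem C4.ord {a : A6} (h : C4 a) : orderOf a = 4 := by
  rw [← Subgroup.orderOf_coe, ← Perm.lcm_cycleType, h]; decide
theorem C5_iff (a : A6) : C5 a ↔ (a : Perm (Fin 6)).cycleType = {5} := by
  constructor
  · intro h
    unfold C5 at h
    rw [← Subgroup.orderOf_coe] at h
    obtain ⟨n, hn⟩ := Perm.cycleType_prime_order (σ := (a : Perm (Fin 6))) (by rw [h]; norm_num)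
    have h1 := Perm.sum_cycleType (a : Perm (Fin 6))
    have h2 := Finset.card_le_univ (Perm.support (a : Perm (Fin 6)))
    rw [← h1, hn, h] at h2
    simp at h2
    have : n = 0 := by omega
    rw [hn, h, this]; rfl
  · intro h
    unfold C5
    rw [← Subgroup.orderOf_coe, ← Perm.lcm_cycleType, h]; decide
theorem card_C2 : (Finset.univ.filter C2).card = 45 := by
  have := AlternatingGroup.card_of_cycleType (Fin 6) {2,2}
  refine (Finset.card_bij (fun a _ => a) ?_ ?_ ?_).trans (this.trans (by decide)) <;> simp [C2_iff]
theorem card_C4 : (Finset.univ.filter C4).card = 90 := by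
  have := AlternatingGroup.card_of_cycleType (Fin 6) {4,2}
  refine (Finset.card_bij (fun a _ => a) ?_ ?_ ?_).trans (this.trans (by decide)) <;> simp [C4_iff]
theorem card_C5 : (Finset.univ.filter C5).card = 144 := by
  have := AlternatingGroup.card_of_cycleType (Fin 6) {5}
  refine (Finset.card_bij (fun a _ => a) ?_ ?_ ?_).trans (this.trans (by decide)) <;> simp [C5_iff]
theorem C5.sq {a : A6} (h : C5 a) : C5 (a^2) := by
  unfold C5 at *
  rw [Nat.Coprime.orderOf_pow] <;> rw [h]; norm_num
theorem sum_C5 {R : Type*} [AddCommMonoid R] (h : A6 → R) : ∑ a with C5 a, h (a^2) = ∑ a with C5 a, h a := by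
  refine Finset.sum_bij' (fun a _ => a^2) (fun a _ => a^3) ?_ ?_ ?_ ?_ ?_
  · intro a ha; simp at *; exact ha.sq
  · intro a ha; simp at *
    unfold C5 at *
    rw [Nat.Coprime.orderOf_pow] <;> rw [ha]; norm_num
  · intro a ha; rw [Finset.mem_filter] at ha; replace ha : orderOf a = 5 := ha.2
    have := pow_orderOf_eq_one a
    rw [ha] at this
    rw [← pow_mul, show 2*3 = 5+1 from rfl, pow_succ, this, one_mul]
  · intro a ha; rw [Finset.mem_filter] at ha; replace ha : orderOf a = 5 := ha.2
    have := pow_orderOf_eq_one a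
    rw [ha] at this
    rw [← pow_mul, show 3*2 = 5+1 from rfl, pow_succ, this, one_mul]
  · intros; rfl
theorem C5_conj {a b : A6} (ha : C5 a) (hb : C5 b) : ∃ x : A6, ∃ k : ℕ, x * a * x⁻¹ = b^k := by
  have : Fact (Nat.Prime 5) := ⟨by norm_num⟩
  have hc : Nat.card A6 = 360 := by
    rw [nat_card_alternatingGroup]; simp; decide
  have hf : (Nat.card A6).factorization 5 = 1 := by
    rw [hc, show 360 = 5 * 72 from rfl, Nat.factorization_mul (by norm_num) (by norm_num)]
    rw [Finsupp.add_apply, Nat.Prime.factorization_self (by norm_num), Nat.factorization_eq_zero_of_not_dvd (by norm_num)]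
  let P : Sylow 5 A6 := Sylow.ofCard (Subgroup.zpowers a) (by rw [hf, Nat.card_zpowers]; exact ha)
  let Q : Sylow 5 A6 := Sylow.ofCard (Subgroup.zpowers b) (by rw [hf, Nat.card_zpowers]; exact hb)
  obtain ⟨x, hx⟩ := MulAction.exists_smul_eq A6 P Q
  have h1 : x * a * x⁻¹ ∈ (x • P : Sylow 5 A6) := by
    exact Subgroup.smul_mem_pointwise_smul a (MulAut.conj x) P.toSubgroup (Subgroup.mem_zpowers a)
  rw [hx] at h1
  have h2 : x * a * x⁻¹ ∈ Subgroup.zpowers b := h1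
  rw [← mem_powers_iff_mem_zpowers] at h2
  obtain ⟨k, hk⟩ := h2
  exact ⟨x, k, hk.symm⟩
theorem C5_pow (P : A6 → Prop) (hc : ∀ x a, P a → P (x * a * x⁻¹)) (hs : ∀ a, C5 a → P a → P (a^2)) {a b : A6} (ha : C5 a) (hb : C5 b) (h : P b) : P a := by
  obtain ⟨x, k, hx⟩ := C5_conj ha hb
  have h5 : b^5 = 1 := by rw [← hb]; exact pow_orderOf_eq_one b
  have hk : b^k = b^(k%5) := by conv_lhs => rw [← Nat.mod_add_div k 5, pow_add, pow_mul, h5, one_pow, mul_one]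
  have hlt := Nat.mod_lt k (show 5 > 0 by norm_num)
  have key : P (b^k) := by
    have p2 := hs _ hb h
    have p4 := hs _ hb.sq p2
    have p3 := hs _ hb.sq.sq p4
    rw [← pow_mul] at p4
    rw [← pow_mul, ← pow_mul, show 2*2*2=5+3 from rfl, pow_add, h5, one_mul] at p3
    rw [hk] at hx ⊢
    generalize k % 5 = m at *
    interval_cases m
    · exfalso
      have : a = 1 := by
        rw [pow_zero] at hx
        have := congrArg (fun y => x⁻¹ * y * x) hx
        simpa [mul_assoc] using this
      rw [this] at ha; simp [C5] at ha
    · simpa using h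
    · exact p2
    · exact p3
    · exact p4
  have := hc x⁻¹ _ key
  rw [← hx] at this
  simpa [mul_assoc] using this
theorem C5.ord {a : A6} (h : C5 a) : orderOf a = 5 := h

theorem sum_cls_s17 {R : Type*} [CommRing R] (h : A6 → R) (y z : R) (h2 : ∀ a, C2 a → h a = y) (h4 : ∀ a, C4 a → h a = z)
    (h0 : ∀ a, a ≠ 1 → ¬ C2 a → ¬ C4 a → ¬ C5 a → h a = 0) :
    ∑ a, h a = h 1 + 45 * y + 90 * z + ∑ a with C5 a, h a := by
  have key : ∀ a, h a = (if a = 1 then h 1 else 0) + (if C2 a then y else 0) + (if C4 a then z else 0) + (if C5 a then h a else 0) := by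
    intro a
    have o1 : a = 1 → orderOf a = 1 := fun h => by simp [h]
    have o2 := @C2.ord a
    have o4 := @C4.ord a
    have o5 := @C5.ord a
    by_cases c1 : a = 1
    · have := o1 c1
      have n2 : ¬ C2 a := fun h => by have := o2 h; omega
      have n4 : ¬ C4 a := fun h => by have := o4 h; omega
      have n5 : ¬ C5 a := fun h => by have := o5 h; omega
      rw [if_pos c1, if_neg n2, if_neg n4, if_neg n5]; simp [c1]
    by_cases c2 : C2 a
    · have := o2 c2
      have n4 : ¬ C4 a := fun h => by have := o4 h; omega
      have n5 : ¬ C5 a := fun h => by have := o5 h; omega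
      simp only [c2, n4, n5, if_false, c1, if_true, add_zero, zero_add, h2 a c2]
    by_cases c4 : C4 a
    · have := o4 c4
      have n5 : ¬ C5 a := fun h => by have := o5 h; omega
      simp only [c2, c4, n5, if_false, c1, if_true, add_zero, zero_add, h4 a c4]
    by_cases c5 : C5 a
    · simp only [c2, c4, c5, if_false, c1, if_true, zero_add]
    · simp only [c2, c4, c5, if_false, c1, zero_add, h0 a c1 c2 c4 c5]
  rw [Finset.sum_congr rfl (fun a _ => key a), Finset.sum_add_distrib, Finset.sum_add_distrib, Finset.sum_add_distrib]
  rw [Finset.sum_ite_eq' Finset.univ (1:A6), if_pos (Finset.mem_univ _)]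
  rw [← Finset.sum_filter, ← Finset.sum_filter, ← Finset.sum_filter, Finset.sum_const, Finset.sum_const, card_C2, card_C4]
  simp only [nsmul_eq_mul]; push_cast; ring

theorem comb (F : A6 → ℝ) (hn : ∀ a, 0 ≤ F a) (h1 : F 1 = 9) (h2 : ∀ a, C2 a → 1 ≤ F a) (h4 : ∀ a, C4 a → 1 ≤ F a)
    (h5 : ∀ a, C5 a → 3 ≤ F a + F (a^2)) (hs : ∑ a, F a = 360) :
    (∀ a, C2 a → F a = 1) ∧ (∀ a, C4 a → F a = 1) ∧ (∀ a, C5 a → F a + F (a^2) = 3) ∧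
    (∀ a, a ≠ 1 → ¬ C2 a → ¬ C4 a → ¬ C5 a → F a = 0) := by
  let H : A6 → ℝ := fun a => if C5 a then (F a + F (a^2)) / 2 else F a
  let l : A6 → ℝ := fun a => if a = 1 then 9 else if C2 a then 1 else if C4 a then 1 else if C5 a then 3/2 else 0
  have n1 : ∀ a, a = 1 → ¬ C5 a := by rintro a rfl; simp [C5]
  have n2 : ∀ a, C2 a → ¬ C5 a ∧ a ≠ 1 := by
    intro a h; have := h.ord
    exact ⟨fun h => by have := h.ord; omega, by rintro rfl; simp at this⟩
  have n4 : ∀ a, C4 a → ¬ C5 a ∧ a ≠ 1 ∧ ¬ C2 a := by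
    intro a h; have := h.ord
    exact ⟨fun h => by have := h.ord; omega, by rintro rfl; simp at this, fun h => by have := h.ord; omega⟩
  have hH : ∑ a, H a = 360 := by
    rw [← hs]
    have e : ∀ a, H a = F a + (if C5 a then (F (a^2))/2 else 0) - (if C5 a then (F a)/2 else 0) := by
      intro a; by_cases c : C5 a <;> simp [H, c]; ring
    rw [Finset.sum_congr rfl (fun a _ => e a), Finset.sum_sub_distrib, Finset.sum_add_distrib, ← Finset.sum_filter, ← Finset.sum_filter,
      sum_C5 (fun a => F a / 2)]
    ring
  have hl : ∑ a, l a = 360 := by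
    rw [sum_cls_s17 l 1 1]
    · have : ∑ a with C5 a, l a = 216 := by
        rw [Finset.sum_congr rfl (g := fun _ => (3/2:ℝ)), Finset.sum_const, card_C5]
        · norm_num
        · intro a ha
          rw [Finset.mem_filter] at ha
          have c1 : a ≠ 1 := fun h => n1 a h ha.2
          have c2 : ¬ C2 a := fun h => (n2 a h).1 ha.2
          have c4 : ¬ C4 a := fun h => (n4 a h).1 ha.2
          simp [l, c1, c2, c4, ha.2]
      rw [this]; simp [l]; norm_num
    · intro a h; simp [l, (n2 a h).2, h]
    · intro a h; simp [l, (n4 a h).2, h]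
    · intro a c1 c2 c4 c5; simp [l, c1, c2, c4, c5]
  have hle : ∀ a ∈ Finset.univ, l a ≤ H a := by
    intro a _
    by_cases c1 : a = 1
    · simp [l, H, c1, n1, h1]
    by_cases c2 : C2 a
    · simp [l, H, c1, c2, n2 a c2, h2]
    by_cases c4 : C4 a
    · simp [l, H, c1, c2, c4, n4 a c4, h4]
    by_cases c5 : C5 a
    · simp [l, H, c1, c2, c4, c5]; linarith [h5 a c5]
    · simp [l, H, c1, c2, c4, c5, hn]
  have heq := (Finset.sum_eq_sum_iff_of_le hle).1 (by rw [hl, hH])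
  refine ⟨?_, ?_, ?_, ?_⟩
  · intro a h; have := heq a (Finset.mem_univ _); simpa [l, H, n2 a h, h] using this.symm
  · intro a h; have := heq a (Finset.mem_univ _); simpa [l, H, n4 a h, h] using this.symm
  · intro a h; have := heq a (Finset.mem_univ _)
    have c1 : a ≠ 1 := fun h' => n1 a h' h
    have c2 : ¬ C2 a := fun h' => (n2 a h').1 h
    have c4 : ¬ C4 a := fun h' => (n4 a h').1 h
    simp [l, H, c1, c2, c4, h] at this
    linarith
  · intro a c1 c2 c4 c5; have := heq a (Finset.mem_univ _); simpa [l, H, c1, c2, c4, c5] using this.symm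
structure Good {G : Type*} [Group G] [Fintype G] (π : G →* A6) (M : G →* Matrix (Fin 3) (Fin 3) ℂ) : Prop where
  surj : Function.Surjective π
  cube : ∀ z, π z = 1 → z^3 = 1
  hdet : ∀ g, (M g).det = 1
  scal : ∀ z, π z = 1 → ∃ c : ℂ, M z = c • (1 : Matrix (Fin 3) (Fin 3) ℂ)
  norm : ∑ g, (M g).trace * (M g⁻¹).trace = 1080
  fib : ∀ h : A6 → ℂ, ∑ g, h (π g) = 3 * ∑ a, h a

namespace Good
variable {G : Type*} [Group G] [Fintype G] {π : G →* A6} {M : G →* Matrix (Fin 3) (Fin 3) ℂ}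

theorem conj_root {n : ℕ} (hn : n ≠ 0) {a : ℂ} (h : a^n = 1) : (starRingEnd ℂ) a = a⁻¹ := by
  have := Complex.norm_eq_one_of_pow_eq_one h hn
  exact (Complex.inv_eq_conj this).symm

set_option linter.unusedSectionVars false
theorem conj (H : Good π M) (g : G) : (M g⁻¹).trace = (starRingEnd ℂ) (M g).trace := by
  have hA : (M g)^(Fintype.card G) = 1 := by rw [← map_pow, pow_card_eq_one, map_one]
  have hAB : M g * M g⁻¹ = 1 := by rw [← map_mul, mul_inv_cancel, map_one]
  obtain ⟨a, b, c, ha, hb, hc, habc, h1, -, h3, -⟩ := pows (M g) (M g⁻¹) (H.hdet g) hAB _ hA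
  have hn : Fintype.card G ≠ 0 := Fintype.card_ne_zero
  rw [h1, h3, map_add, map_add, conj_root hn ha, conj_root hn hb, conj_root hn hc]
  have a0 : a ≠ 0 := by rintro rfl; simp at habc
  have b0 : b ≠ 0 := by rintro rfl; simp at habc
  have c0 : c ≠ 0 := by rintro rfl; simp at habc
  field_simp
  linear_combination (a*b+b*c+c*a) * habc

theorem nsq (H : Good π M) (g : G) : (M g).trace * (M g⁻¹).trace = (Complex.normSq (M g).trace : ℂ) := by
  rw [H.conj, Complex.mul_conj]

theorem scal' (H : Good π M) (z : G) (hz : π z = 1) : ∃ c : ℂ, M z = c • (1 : Matrix (Fin 3) (Fin 3) ℂ) ∧ c^3 = 1 ∧ Complex.normSq c = 1 := by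
  obtain ⟨c, hc⟩ := H.scal z hz
  have h3 : c^3 = 1 := by
    have : M (z^3) = 1 := by rw [H.cube z hz, map_one]
    rw [map_pow, hc, smul_pow, one_pow] at this
    have := congrFun (congrFun this 0) 0
    simpa using this
  refine ⟨c, hc, h3, ?_⟩
  have := Complex.norm_eq_one_of_pow_eq_one h3 (by norm_num)
  rw [Complex.normSq_eq_norm_sq, this, one_pow]

theorem tr_mul (H : Good π M) (z g : G) (c : ℂ) (hc : M z = c • (1 : Matrix (Fin 3) (Fin 3) ℂ)) : (M (z*g)).trace = c * (M g).trace := by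
  rw [map_mul, hc, smul_mul_assoc, one_mul, Matrix.trace_smul, smul_eq_mul]

theorem nwd (H : Good π M) (g g' : G) (h : π g = π g') : Complex.normSq (M g).trace = Complex.normSq (M g').trace := by
  obtain ⟨c, hc, -, h1⟩ := H.scal' (g*g'⁻¹) (by rw [map_mul, map_inv, h, mul_inv_cancel])
  have := H.tr_mul _ g' c hc
  rw [inv_mul_cancel_right] at this
  rw [this, Complex.normSq_mul, h1, one_mul]

theorem p21 (H : Good π M) (g : G) (h : π g ^ 20 = 1) : π (g^21) = π g := by
  rw [map_pow, pow_succ, h, one_mul]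

theorem pn (H : Good π M) {n : ℕ} (g : G) (h : π g ^ n = 1) : (g^21)^n = 1 := by
  rw [← pow_mul, mul_comm, pow_mul, show 21 = 3 * 7 from rfl, pow_mul, H.cube _ (by rw [map_pow, h]), one_pow]

/-- The main value computation. -/
theorem core (H : Good π M) :
    (∀ g, π g = 1 → Complex.normSq (M g).trace = 9) ∧
    (∀ g, C2 (π g) → Complex.normSq (M g).trace = 1 ∧ (M (g^21)).trace = -1) ∧
    (∀ g, C4 (π g) → Complex.normSq (M g).trace = 1 ∧ (M (g^21)).trace = 1) ∧
    (∀ g, C5 (π g) → Complex.normSq (M g).trace + Complex.normSq (M (g^2)).trace = 3 ∧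
       Complex.normSq (M g).trace ^ 2 - 3 * Complex.normSq (M g).trace + 1 = 0 ∧
       (M (g^21)).trace = Complex.normSq (M g).trace - 1) ∧
    (∀ g, π g ≠ 1 → ¬ C2 (π g) → ¬ C4 (π g) → ¬ C5 (π g) → (M g).trace = 0) := by
  have o2 : ∀ g, C2 (π g) → π g ^ 2 = 1 := fun g h => by rw [← h.ord]; exact pow_orderOf_eq_one _
  have o4 : ∀ g, C4 (π g) → π g ^ 4 = 1 := fun g h => by rw [← h.ord]; exact pow_orderOf_eq_one _
  have o5 : ∀ g, C5 (π g) → π g ^ 5 = 1 := fun g h => by rw [← h.ord]; exact pow_orderOf_eq_one _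
  have o2' : ∀ g, C2 (π g) → π g ^ 20 = 1 := fun g h => by rw [show 20 = 2*10 from rfl, pow_mul, o2 g h, one_pow]
  have o4' : ∀ g, C4 (π g) → π g ^ 20 = 1 := fun g h => by rw [show 20 = 4*5 from rfl, pow_mul, o4 g h, one_pow]
  have o5' : ∀ g, C5 (π g) → π g ^ 20 = 1 := fun g h => by rw [show 20 = 5*4 from rfl, pow_mul, o5 g h, one_pow]
  have hAB : ∀ g, M g * M g⁻¹ = 1 := fun g => by rw [← map_mul, mul_inv_cancel, map_one]
  have v1 : ∀ g, π g = 1 → Complex.normSq (M g).trace = 9 := by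
    intro g hg
    rw [H.nwd g 1 (by simpa using hg)]
    simp; norm_num
  have v2 : ∀ g, C2 (π g) → ((M (g^21)).trace = -1 ∧ Complex.normSq (M g).trace = 1) ∨ Complex.normSq (M g).trace = 9 := by
    intro g hg
    rw [← H.nwd (g^21) g (H.p21 g (o2' g hg))]
    have hn := H.nsq (g^21)
    obtain ⟨a, b, c, ha, hb, hc, habc, h1, -, h3, -⟩ := pows (M (g^21)) (M (g^21)⁻¹) (H.hdet _) (hAB _) 2 (by rw [← map_pow, H.pn g (o2 g hg), map_one])
    rw [h3] at hn
    rcases two a b c ha hb habc with h | h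
    · left; rw [h1, h.1]; simp
    · right; rw [h1, h] at hn; rw [h1]; exact_mod_cast hn.symm
  have v4 : ∀ g, C4 (π g) → ((M (g^21)).trace = 1 ∧ Complex.normSq (M g).trace = 1) ∨
      (Complex.normSq (M g).trace = 1 ∧ Complex.normSq (M (g^2)).trace = 9) ∨ Complex.normSq (M g).trace = 5 ∨ Complex.normSq (M g).trace = 9 := by
    intro g hg
    have e := H.p21 g (o4' g hg)
    rw [← H.nwd (g^21) g e, ← H.nwd ((g^21)^2) (g^2) (by rw [map_pow, e, map_pow])]
    have hn := H.nsq (g^21)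
    obtain ⟨a, b, c, ha, hb, hc, habc, h1, h2, h3, -⟩ := pows (M (g^21)) (M (g^21)⁻¹) (H.hdet _) (hAB _) 4 (by rw [← map_pow, H.pn g (o4 g hg), map_one])
    rw [h3] at hn
    rw [map_pow M (g^21) 2, h2]
    rcases four a b c ha hb habc with h | h | h | h
    · left; rw [h1, h.1]; simp
    · right; left; rw [h1, h.1, h.2.2]; simp; norm_num
    · right; right; left; rw [h1, h] at hn; rw [h1]; exact_mod_cast hn.symm
    · right; right; right; rw [h1, h] at hn; rw [h1]; exact_mod_cast hn.symm
  have v5 : ∀ g, C5 (π g) → (Complex.normSq (M g).trace + Complex.normSq (M (g^2)).trace = 3 ∧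
       Complex.normSq (M g).trace ^ 2 - 3 * Complex.normSq (M g).trace + 1 = 0 ∧
       (M (g^21)).trace = Complex.normSq (M g).trace - 1) ∨ 
       3 < Complex.normSq (M g).trace + Complex.normSq (M (g^2)).trace := by
    intro g hg
    have e := H.p21 g (o5' g hg)
    rw [← H.nwd (g^21) g e, ← H.nwd ((g^21)^2) (g^2) (by rw [map_pow, e, map_pow])]
    have hn := H.nsq (g^21)
    have hn2 := H.nsq ((g^21)^2)
    obtain ⟨a, b, c, ha, hb, hc, habc, h1, h2, h3, h4⟩ := pows (M (g^21)) (M (g^21)⁻¹) (H.hdet _) (hAB _) 5 (by rw [← map_pow, H.pn g (o5 g hg), map_one])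
    rw [h3] at hn
    rw [← inv_pow, map_pow M _ 2, map_pow M _ 2, h4] at hn2
    rw [map_pow M (g^21) 2]
    generalize Complex.normSq (M (g^21)).trace = N at *
    generalize Complex.normSq ((M (g^21))^2).trace = N2 at *
    rw [h1] at hn ⊢
    rw [h2] at hn2
    rcases five a b c ha hb habc with ⟨h, h', h'', -⟩ | h | h
    · left
      have hN : (N:ℂ) = a+b+c+1 := by rw [← hn, h', ← h'']; ring
      refine ⟨?_, ?_, ?_⟩
      · rw [hn, hn2] at h; exact_mod_cast h
      · have : (N:ℂ)^2 - 3 * N + 1 = 0 := by rw [hN]; linear_combination h''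
        exact_mod_cast this
      · rw [hN]; ring
    · right
      rw [hn, hn2] at h
      have : N + N2 = 8 := by exact_mod_cast h
      rw [this]; norm_num
    · right
      rw [hn, hn2] at h
      have : N + N2 = 18 := by exact_mod_cast h
      rw [this]; norm_num
  let sec : A6 → G := Function.surjInv H.surj
  have hsec : ∀ a, π (sec a) = a := Function.surjInv_eq H.surj
  let F : A6 → ℝ := fun a => Complex.normSq (M (sec a)).trace
  have hF : ∀ g, Complex.normSq (M g).trace = F (π g) := fun g => H.nwd _ _ (hsec _).symm
  have hF2 : ∀ g, Complex.normSq (M (g^2)).trace = F (π g ^ 2) := fun g => by rw [hF, map_pow]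
  have hs : ∑ a, F a = 360 := by
    have h1 := H.fib (fun a => (F a : ℂ))
    have h2 := H.norm
    rw [Finset.sum_congr rfl (fun g _ => (H.nsq g).trans (by rw [hF g])), h1] at h2
    have : (3:ℝ) * ∑ a, F a = 1080 := by exact_mod_cast h2
    linarith
  obtain ⟨c2, c4, c5, c0⟩ := comb F (fun a => Complex.normSq_nonneg _) (v1 _ (hsec 1))
    (by
      intro a ha
      have := v2 (sec a) (by rwa [hsec])
      rw [hF, hsec] at this
      rcases this with h | h
      · rw [h.2]
      · rw [h]; norm_num)
    (by
      intro a ha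
      have := v4 (sec a) (by rwa [hsec])
      rw [hF, hsec] at this
      rcases this with h | h | h | h
      · rw [h.2]
      · rw [h.1]
      · rw [h]; norm_num
      · rw [h]; norm_num)
    (by
      intro a ha
      have := v5 (sec a) (by rwa [hsec])
      rw [hF2, hF, hsec] at this
      rcases this with h | h
      · rw [h.1]
      · exact h.le) hs
  refine ⟨v1, ?_, ?_, ?_, ?_⟩
  · intro g hg
    have := c2 _ hg
    have h' := v2 g hg
    rw [hF, this] at h' ⊢
    rcases h' with h | h
    · exact ⟨rfl, h.1⟩
    · norm_num at h
  · intro g hg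
    have := c4 _ hg
    have h' := v4 g hg
    rw [hF2, hF, this] at h'
    rw [hF, this]
    have hne : π g ^ 2 ≠ 1 := by
      intro h
      have := orderOf_le_of_pow_eq_one (by norm_num) h
      rw [hg.ord] at this; omega
    rcases h' with h | h | h | h
    · exact ⟨rfl, h.1⟩
    · exfalso
      have h9 := h.2
      generalize π g ^ 2 = b at *
      by_cases d2 : C2 b
      · rw [c2 b d2] at h9; norm_num at h9
      by_cases d4 : C4 b
      · rw [c4 b d4] at h9; norm_num at h9
      by_cases d5 : C5 b
      · have := c5 b d5
        have h0 : 0 ≤ F (b^2) := Complex.normSq_nonneg _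
        linarith
      · rw [c0 b hne d2 d4 d5] at h9; norm_num at h9
    · norm_num at h
    · norm_num at h
  · intro g hg
    have := c5 _ hg
    rcases v5 g hg with h | h
    · exact h
    · rw [hF2, hF] at h; linarith
  · intro g d1 d2 d4 d5
    have := c0 _ d1 d2 d4 d5
    rw [← hF] at this
    exact Complex.normSq_eq_zero.1 this

theorem nontriv (H : Good π M) (hs0 : ∑ g, (M g).trace = 0) : ¬ (∀ z, π z = 1 → M z = 1) := by
  intro htr
  obtain ⟨k1, k2, k4, k5, k0⟩ := H.core
  let sec : A6 → G := Function.surjInv H.surj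
  have hsec : ∀ a, π (sec a) = a := Function.surjInv_eq H.surj
  have hw : ∀ g, (M g).trace = (M (sec (π g))).trace := by
    intro g
    have h1 := htr (g * (sec (π g))⁻¹) (by rw [map_mul, map_inv, hsec, mul_inv_cancel])
    have : g = g * (sec (π g))⁻¹ * sec (π g) := by group
    conv_lhs => rw [this, map_mul, h1, one_mul]
  have h21 : ∀ g, π g ^ 20 = 1 → (M (g^21)).trace = (M g).trace := by
    intro g hg
    rw [pow_succ, map_mul, htr (g^20) (by rw [map_pow, hg]), one_mul]
  have hof : ∀ a : A6, orderOf a ∣ 20 → π (sec a) ^ 20 = 1 := fun a ha => by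
    rw [hsec]; exact orderOf_dvd_iff_pow_eq_one.1 ha
  let F : A6 → ℝ := fun a => Complex.normSq (M (sec a)).trace
  have hF : ∀ g, Complex.normSq (M g).trace = F (π g) := fun g => H.nwd _ _ (hsec _).symm
  have h5 : ∑ a with C5 a, (F a : ℂ) = 216 := by
    have e1 : ∑ a with C5 a, ((F a : ℂ) + (F (a^2) : ℂ)) = 432 := by
      rw [Finset.sum_congr rfl (g := fun _ => (3:ℂ)), Finset.sum_const, card_C5]
      · norm_num
      · intro a ha
        rw [Finset.mem_filter] at ha
        have := (k5 (sec a) (by rw [hsec]; exact ha.2)).1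
        rw [hF (sec a ^ 2), map_pow, hF, hsec] at this
        exact_mod_cast this
    rw [Finset.sum_add_distrib, sum_C5 (fun a => (F a : ℂ))] at e1
    linear_combination e1 / 2
  have hsum := H.fib (fun a => (M (sec a)).trace)
  rw [← Finset.sum_congr rfl (fun g _ => hw g), hs0, sum_cls_s17 _ (-1) 1] at hsum
  · have e5 : ∑ a with C5 a, (M (sec a)).trace = 72 := by
      rw [Finset.sum_congr rfl (g := fun a => (F a : ℂ) - 1), Finset.sum_sub_distrib, h5, Finset.sum_const, card_C5]
      · norm_num
      · intro a ha
        rw [Finset.mem_filter] at ha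
        have := (k5 (sec a) (by rw [hsec]; exact ha.2)).2.2
        rw [h21 _ (hof a (by rw [ha.2.ord]; norm_num))] at this
        exact this
    rw [e5, htr (sec 1) (hsec 1)] at hsum
    simp at hsum
    norm_num at hsum
  · intro a ha
    rw [← h21 _ (hof a (by rw [ha.ord]; norm_num))]
    exact (k2 (sec a) (by rw [hsec]; exact ha)).2
  · intro a ha
    rw [← h21 _ (hof a (by rw [ha.ord]; norm_num))]
    exact (k4 (sec a) (by rw [hsec]; exact ha)).2
  · intro a d1 d2 d4 d5
    exact k0 (sec a) (by rwa [hsec]) (by rwa [hsec]) (by rwa [hsec]) (by rwa [hsec])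

theorem final (H : Good π M) {M' : G →* Matrix (Fin 3) (Fin 3) ℂ} (H' : Good π M')
    (hs : ∑ g, (M g).trace = 0) (hs' : ∑ g, (M' g).trace = 0)
    (z0 : G) (hz0 : π z0 = 1) (hgen : ∀ z, π z = 1 → ∃ i : ℕ, z0 ^ i = z) :
    (∀ g, (M' g).trace = (M g).trace) ∨ (∀ g, (M' g).trace = (starRingEnd ℂ) (M g).trace) ∨
    ∑ g, Complex.normSq (M g).trace * Complex.normSq (M' g).trace = 1080 := by
  obtain ⟨k1, k2, k4, k5, k0⟩ := H.core
  obtain ⟨l1, l2, l4, l5, l0⟩ := H'.core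
  let sec : A6 → G := Function.surjInv H.surj
  have hsec : ∀ a, π (sec a) = a := Function.surjInv_eq H.surj
  by_cases hD : ∃ g, C5 (π g) ∧ Complex.normSq (M g).trace = Complex.normSq (M' g).trace
  · obtain ⟨g0, hg0, he⟩ := hD
    have hall : ∀ g, C5 (π g) → Complex.normSq (M g).trace = Complex.normSq (M' g).trace := by
      intro g hg
      refine C5_pow (fun a => ∀ g, π g = a → Complex.normSq (M g).trace = Complex.normSq (M' g).trace) ?_ ?_ hg hg0 ?_ g rfl
      · intro x a ha g hg
        have := ha ((sec x)⁻¹ * g * sec x) (by rw [map_mul, map_mul, map_inv, hsec, hg]; group)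
        have tc : ∀ N : G →* Matrix (Fin 3) (Fin 3) ℂ, (N ((sec x)⁻¹ * g * sec x)).trace = (N g).trace := by
          intro N
          rw [map_mul, Matrix.trace_mul_comm, ← map_mul]
          congr 2; group
        rwa [tc, tc] at this
      · intro a ha hP g hg
        have e1 := (k5 (sec a) (by rwa [hsec])).1
        have e2 := (l5 (sec a) (by rwa [hsec])).1
        have e3 := hP (sec a) (hsec a)
        have e : π g = π (sec a ^ 2) := by rw [hg, map_pow, hsec]
        rw [H.nwd g _ e, H'.nwd g _ e]
        linarith
      · intro g hg
        rw [H.nwd g g0 hg, H'.nwd g g0 hg, he]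
    obtain ⟨c, hc, hc3, hcn⟩ := H.scal' z0 hz0
    obtain ⟨d, hd, hd3, hdn⟩ := H'.scal' z0 hz0
    have hc1 : c ≠ 1 := by
      rintro rfl
      refine H.nontriv hs fun z hz => ?_
      obtain ⟨i, rfl⟩ := hgen z hz
      rw [map_pow, hc, one_smul, one_pow]
    have hd1 : d ≠ 1 := by
      rintro rfl
      refine H'.nontriv hs' fun z hz => ?_
      obtain ⟨i, rfl⟩ := hgen z hz
      rw [map_pow, hd, one_smul, one_pow]
    have c0 : c ≠ 0 := by rintro rfl; simp at hc3
    have d0 : d ≠ 0 := by rintro rfl; simp at hd3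
    have hr : ∀ g, ((M g).trace = 0 ∧ (M' g).trace = 0) ∨ ∃ i : ℕ, ∃ r : ℝ, c^i * (M g).trace = r ∧ d^i * (M' g).trace = r := by
      intro g
      have mk : π g ^ 20 = 1 → ∀ r : ℝ, (M (g^21)).trace = r → (M' (g^21)).trace = r →
          ∃ i : ℕ, ∃ r : ℝ, c^i * (M g).trace = r ∧ d^i * (M' g).trace = r := by
        intro h20 r h1 h2
        obtain ⟨i, hi⟩ := hgen (g^20) (by rw [map_pow, h20])
        refine ⟨i, r, ?_, ?_⟩
        · rw [← h1, pow_succ, H.tr_mul (g^20) g (c^i) (by rw [← hi, map_pow, hc, smul_pow, one_pow])]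
        · rw [← h2, pow_succ, H'.tr_mul (g^20) g (d^i) (by rw [← hi, map_pow, hd, smul_pow, one_pow])]
      have hof : orderOf (π g) ∣ 20 → π g ^ 20 = 1 := fun h => orderOf_dvd_iff_pow_eq_one.1 h
      by_cases d1 : π g = 1
      · right
        refine mk (by rw [d1, one_pow]) 3 ?_ ?_
        · rw [show 21 = 3 * 7 from rfl, pow_mul, H.cube g d1, one_pow, map_one]; simp
        · rw [show 21 = 3 * 7 from rfl, pow_mul, H.cube g d1, one_pow, map_one]; simp
      by_cases d2 : C2 (π g)
      · right
        exact mk (hof (by rw [d2.ord]; norm_num)) (-1) (by rw [(k2 g d2).2]; simp) (by rw [(l2 g d2).2]; simp)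
      by_cases d4 : C4 (π g)
      · right
        exact mk (hof (by rw [d4.ord]; norm_num)) 1 (by rw [(k4 g d4).2]; simp) (by rw [(l4 g d4).2]; simp)
      by_cases d5 : C5 (π g)
      · right
        exact mk (hof (by rw [d5.ord]; norm_num)) (Complex.normSq (M g).trace - 1) (by rw [(k5 g d5).2.2]; simp)
          (by rw [(l5 g d5).2.2, hall g d5]; simp)
      · left; exact ⟨k0 g d1 d2 d4 d5, l0 g d1 d2 d4 d5⟩
    have hcd : d = c ∨ d = c^2 := by
      have e1 : c^2+c+1 = 0 := by
        have : (c-1)*(c^2+c+1) = 0 := by linear_combination hc3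
        exact (mul_eq_zero.1 this).resolve_left (sub_ne_zero.2 hc1)
      have e2 : d^2+d+1 = 0 := by
        have : (d-1)*(d^2+d+1) = 0 := by linear_combination hd3
        exact (mul_eq_zero.1 this).resolve_left (sub_ne_zero.2 hd1)
      have : (d-c)*(d-c^2) = 0 := by linear_combination e2 - d * e1 + hc3
      rcases mul_eq_zero.1 this with h | h
      · left; linear_combination h
      · right; linear_combination h
    rcases hcd with rfl | hcd
    · left
      intro g
      rcases hr g with h | ⟨i, r, h1, h2⟩
      · rw [h.1, h.2]
      · exact mul_left_cancel₀ (pow_ne_zero i d0) (h2.trans h1.symm)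
    · right; left
      have hconj : (starRingEnd ℂ) c = d := by
        rw [conj_root (by norm_num) hc3, hcd]
        field_simp; exact hc3.symm
      intro g
      rcases hr g with h | ⟨i, r, h1, h2⟩
      · rw [h.1, h.2, map_zero]
      · have h3 := congrArg (starRingEnd ℂ) h1
        rw [map_mul, map_pow, hconj, Complex.conj_ofReal] at h3
        exact mul_left_cancel₀ (pow_ne_zero i d0) (h2.trans h3.symm)
  · right; right
    push Not at hD
    let E : A6 → ℂ := fun a => (Complex.normSq (M (sec a)).trace * Complex.normSq (M' (sec a)).trace : ℝ)
    have hE : ∀ g, ((Complex.normSq (M g).trace * Complex.normSq (M' g).trace : ℝ) : ℂ) = E (π g) := by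
      intro g
      have e : π g = π (sec (π g)) := (hsec _).symm
      rw [H.nwd g _ e, H'.nwd g _ e]
    have hsum := H.fib E
    rw [← Finset.sum_congr rfl (fun g _ => hE g), sum_cls_s17 E 1 1] at hsum
    · have e5 : ∑ a with C5 a, E a = 144 := by
        rw [Finset.sum_congr rfl (g := fun a => (1:ℂ)), Finset.sum_const, card_C5]
        · norm_num
        · intro a ha
          rw [Finset.mem_filter] at ha
          have c5 : C5 (π (sec a)) := by rw [hsec]; exact ha.2
          have e1 := (k5 _ c5).2.1
          have e2 := (l5 _ c5).2.1
          have e3 := hD _ c5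
          simp only [E]
          generalize Complex.normSq (M (sec a)).trace = x at *
          generalize Complex.normSq (M' (sec a)).trace = y at *
          have : (x - y) * (x * y - 1) = 0 := by linear_combination y * e1 - x * e2
          have := (mul_eq_zero.1 this).resolve_left (sub_ne_zero.2 e3)
          have : x * y = 1 := by linarith
          rw [this]; simp
      have e1 : E 1 = 81 := by simp only [E]; rw [k1 _ (hsec 1), l1 _ (hsec 1)]; norm_num
      rw [e5, e1] at hsum
      norm_num at hsum
      exact_mod_cast hsum
    · intro a ha
      have c : C2 (π (sec a)) := by rw [hsec]; exact ha
      simp only [E]; rw [(k2 _ c).1, (l2 _ c).1]; simp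
    · intro a ha
      have c : C4 (π (sec a)) := by rw [hsec]; exact ha
      simp only [E]; rw [(k4 _ c).1, (l4 _ c).1]; simp
    · intro a d1 d2 d4 d5
      simp only [E]
      rw [k0 (sec a) (by rwa [hsec]) (by rwa [hsec]) (by rwa [hsec]) (by rwa [hsec])]; simp
end Good

section Build
set_option linter.unusedSectionVars false
variable {G : Type*} [Group G] [Fintype G]

noncomputable def matOf (ρ : Representation ℂ G (Fin 3 → ℂ)) : G →* Matrix (Fin 3) (Fin 3) ℂ :=
  ((LinearMap.toMatrixAlgEquiv' (R := ℂ) (n := Fin 3)) : ((Fin 3 → ℂ) →ₗ[ℂ] (Fin 3 → ℂ)) →* Matrix (Fin 3) (Fin 3) ℂ).comp ρ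

theorem matOf_mulVec (ρ : Representation ℂ G (Fin 3 → ℂ)) (g : G) (v : Fin 3 → ℂ) : (matOf ρ g) *ᵥ v = ρ g v := by
  have : matOf ρ g = LinearMap.toMatrix' (ρ g) := rfl
  rw [this, ← Matrix.toLin'_apply, Matrix.toLin'_toMatrix']

theorem matOf_trace (ρ : Representation ℂ G (Fin 3 → ℂ)) (g : G) : (matOf ρ g).trace = LinearMap.trace ℂ (Fin 3 → ℂ) (ρ g) := by
  have : matOf ρ g = LinearMap.toMatrix' (ρ g) := rfl
  rw [this, LinearMap.trace_eq_matrix_trace ℂ (Pi.basisFun ℂ (Fin 3)), LinearMap.toMatrix_eq_toMatrix']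

variable (M : G →* Matrix (Fin 3) (Fin 3) ℂ)

theorem schur_mat
    (hirr : ∀ p : Submodule ℂ (Fin 3 → ℂ), (∀ g, ∀ v ∈ p, M g *ᵥ v ∈ p) → p = ⊥ ∨ p = ⊤)
    (T : Matrix (Fin 3) (Fin 3) ℂ) (hT : ∀ g, T * M g = M g * T) :
    ∃ c : ℂ, T = c • (1 : Matrix (Fin 3) (Fin 3) ℂ) := by
  obtain ⟨c, hc⟩ := Module.End.exists_eigenvalue (K := ℂ) (V := Fin 3 → ℂ) (Matrix.toLin' T)
  have hmem : ∀ v, v ∈ Module.End.eigenspace (R := ℂ) (M := Fin 3 → ℂ) (Matrix.toLin' T) c ↔ T *ᵥ v = c • v := by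
    intro v
    rw [Module.End.mem_eigenspace_iff, Matrix.toLin'_apply]
  rcases hirr (Module.End.eigenspace (R := ℂ) (M := Fin 3 → ℂ) (Matrix.toLin' T) c) (by
    intro g v hv
    rw [hmem] at hv ⊢
    rw [mulVec_mulVec, hT, ← mulVec_mulVec, hv, mulVec_smul]) with h | h
  · exact absurd h hc
  · refine ⟨c, ?_⟩
    apply Matrix.toLin'.injective
    ext1 i
    have : ∀ v, T *ᵥ v = c • v := fun v => by rw [← hmem, h]; trivial
    ext j
    simp [this, Matrix.smul_mulVec]

theorem sum_trace_zero
    (hirr : ∀ p : Submodule ℂ (Fin 3 → ℂ), (∀ g, ∀ v ∈ p, M g *ᵥ v ∈ p) → p = ⊥ ∨ p = ⊤)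
    : ∑ g, (M g).trace = 0 := by
  have key : ∑ g, M g = 0 := by
    have hinv : ∀ h, M h * ∑ g, M g = ∑ g, M g := by
      intro h
      rw [Finset.mul_sum]
      exact Fintype.sum_equiv (Equiv.mulLeft h) _ _ (fun g => by simp)
    apply Matrix.toLin'.injective
    refine LinearMap.ext fun v => ?_
    rw [Matrix.toLin'_apply, map_zero, LinearMap.zero_apply]
    rcases hirr (Submodule.span ℂ {(∑ g, M g) *ᵥ v}) (by
      intro g w hw
      rw [Submodule.mem_span_singleton] at hw ⊢
      obtain ⟨a, rfl⟩ := hw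
      exact ⟨a, by rw [mulVec_smul, mulVec_mulVec, hinv]⟩) with h | h
    · exact Submodule.span_singleton_eq_bot.1 h
    · exfalso
      have h1 := finrank_span_le_card (R := ℂ) ({(∑ g, M g) *ᵥ v} : Set (Fin 3 → ℂ))
      rw [h] at h1
      simp at h1
  rw [← Matrix.trace_sum, key, Matrix.trace_zero]

theorem sum_norm
    (hirr : ∀ p : Submodule ℂ (Fin 3 → ℂ), (∀ g, ∀ v ∈ p, M g *ᵥ v ∈ p) → p = ⊥ ∨ p = ⊤)
    : ∑ g, (M g).trace * (M g⁻¹).trace = Fintype.card G := by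
  have hinv : ∀ i j : Fin 3, ∃ c : ℂ, ∑ g, M g * Matrix.single i j 1 * M g⁻¹ = c • (1 : Matrix (Fin 3) (Fin 3) ℂ) := by
    intro i j
    apply schur_mat M hirr
    intro h
    rw [Finset.sum_mul, Finset.mul_sum]
    refine Fintype.sum_equiv (Equiv.mulLeft h⁻¹) _ _ (fun g => ?_)
    simp only [Equiv.coe_mulLeft]
    rw [_root_.mul_inv_rev, inv_inv, map_mul M h⁻¹, map_mul M g⁻¹ h]
    have : M h * M h⁻¹ = 1 := by rw [← map_mul, mul_inv_cancel, map_one]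
    simp only [← mul_assoc]
    rw [this, one_mul]
  have hentry : ∀ i j : Fin 3, ∑ g, M g i i * M g⁻¹ j j = if i = j then (Fintype.card G : ℂ) / 3 else 0 := by
    intro i j
    obtain ⟨c, hc⟩ := hinv i j
    have h1 := congrFun (congrFun hc i) j
    have h2 := congrArg Matrix.trace hc
    have e1 : ∀ g : G, (M g * Matrix.single i j (1:ℂ) * M g⁻¹ : Matrix (Fin 3) (Fin 3) ℂ) i j = M g i i * M g⁻¹ j j := by
      intro g
      rw [Matrix.mul_assoc, Matrix.mul_apply, Finset.sum_eq_single i]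
      · simp [Matrix.single_mul_apply_same]
      · intro k _ hk
        rw [Matrix.single_mul_apply_of_ne, mul_zero]; exact hk
      · simp
    rw [Matrix.sum_apply, Finset.sum_congr rfl (fun g _ => e1 g)] at h1
    rw [h1]
    have e2 : ∀ g, (M g * Matrix.single i j 1 * M g⁻¹).trace = (Matrix.single i j (1:ℂ)).trace := by
      intro g
      rw [Matrix.trace_mul_comm, ← mul_assoc, ← map_mul, inv_mul_cancel, map_one, one_mul]
    rw [Matrix.trace_sum, Finset.sum_congr rfl (fun g _ => e2 g)] at h2
    by_cases hij : i = j
    · subst hij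
      simp at h2 ⊢
      rw [h2]; ring
    · simp [hij]
  have : ∀ g, (M g).trace * (M g⁻¹).trace = ∑ i, ∑ j, M g i i * M g⁻¹ j j := by
    intro g
    simp only [Matrix.trace, Matrix.diag, Finset.sum_mul_sum]
  rw [Finset.sum_congr rfl (fun g _ => this g), Finset.sum_comm]
  have : ∀ i : Fin 3, ∑ g, ∑ j, M g i i * M g⁻¹ j j = (Fintype.card G : ℂ) / 3 := by
    intro i
    rw [Finset.sum_comm, Finset.sum_congr rfl (fun j _ => hentry i j)]
    simp
  rw [Finset.sum_congr rfl (fun i _ => this i)]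
  simp; ring

theorem mkGood
    (hirr : ∀ p : Submodule ℂ (Fin 3 → ℂ), (∀ g, ∀ v ∈ p, M g *ᵥ v ∈ p) → p = ⊥ ∨ p = ⊤)
    (hperfect : commutator G = ⊤) (hcard : Nat.card G = 1080)
    (hcenter : Nat.card (Subgroup.center G) = 3) (π : G →* A6) (hsurj : Function.Surjective π)
    (hker : ∀ g, π g = 1 ↔ g ∈ Subgroup.center G) : Good π M where
  surj := hsurj
  cube := by
    intro z hz
    have := pow_card_eq_one' (x := (⟨z, (hker z).1 hz⟩ : Subgroup.center G))
    rw [hcenter] at this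
    exact congrArg Subtype.val this
  hdet := by
    intro g
    let D : G →* ℂˣ := (Matrix.detMonoidHom.comp M).toHomUnits
    have h1 : commutator G ≤ D.ker := Abelianization.commutator_subset_ker D
    rw [hperfect] at h1
    have h2 : D g = 1 := h1 (Subgroup.mem_top g)
    exact congrArg Units.val h2
  scal := by
    intro z hz
    apply schur_mat M hirr
    intro g
    rw [← map_mul, ← map_mul, Subgroup.mem_center_iff.1 ((hker z).1 hz) g]
  norm := by
    rw [sum_norm M hirr, ← Nat.card_eq_fintype_card, hcard]; norm_num
  fib := by
    classical
    intro h
    rw [← Finset.sum_fiberwise Finset.univ π, Finset.mul_sum]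
    refine Finset.sum_congr rfl fun a _ => ?_
    rw [Finset.sum_congr rfl (g := fun _ => h a), Finset.sum_const,
      MonoidHom.card_fiber_eq_of_mem_range π (hsurj a) (hsurj 1)]
    · have : (Finset.univ.filter (fun g => π g = 1)).card = 3 := by
        rw [← hcenter, Nat.card_eq_fintype_card, Fintype.card_subtype]
        congr 1; ext g; simp [hker]
      rw [this]; simp
    · intro g hg
      rw [(Finset.mem_filter.1 hg).2]
end Build

/-- Let `G` be a finite perfect group of order 1080 whose center has order 3,
with `G / Z(G) ≅ A₆` (so `G` is the triple cover `3.A₆ = Σ(360φ)`).  Let `f` and `lam` be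
characters of irreducible 3-dimensional complex representations of `G` with `lam` equal
neither to `f` nor to the complex conjugate character of `f`.  Then `⟨lam·f, lam·f⟩ = 1`:
the tensor product of the corresponding representations is irreducible. -/
theorem sigma360phi_twisted_one_group
    {G : Type*} [Group G] [Fintype G]
    (hperfect : commutator G = ⊤)
    (hcard : Nat.card G = 1080)
    (hcenter : Nat.card (Subgroup.center G) = 3)
    (hquot : Nonempty ((G ⧸ Subgroup.center G) ≃* alternatingGroup (Fin 6)))
    (ρf ρl : Representation ℂ G (Fin 3 → ℂ))
    (hfirr : ∀ p : Submodule ℂ (Fin 3 → ℂ),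
      (∀ g, ∀ v ∈ p, ρf g v ∈ p) → p = ⊥ ∨ p = ⊤)
    (hlirr : ∀ p : Submodule ℂ (Fin 3 → ℂ),
      (∀ g, ∀ v ∈ p, ρl g v ∈ p) → p = ⊥ ∨ p = ⊤)
    (f lam : G → ℂ)
    (hf : ∀ g, f g = LinearMap.trace ℂ (Fin 3 → ℂ) (ρf g))
    (hlam : ∀ g, lam g = LinearMap.trace ℂ (Fin 3 → ℂ) (ρl g))
    (hne : lam ≠ f) (hneconj : lam ≠ fun g => (starRingEnd ℂ) (f g)) :
    innerChar _ (fun g => lam g * f g) (fun g => lam g * f g) = 1 := by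
  obtain ⟨e⟩ := hquot
  let π : G →* A6 := e.toMonoidHom.comp (QuotientGroup.mk' (Subgroup.center G))
  have hsurj : Function.Surjective π := e.surjective.comp (QuotientGroup.mk'_surjective _)
  have hker : ∀ g, π g = 1 ↔ g ∈ Subgroup.center G := by
    intro g
    have : π g = e (g : G ⧸ Subgroup.center G) := rfl
    rw [this, map_eq_one_iff e e.injective, QuotientGroup.eq_one_iff]
  have i1 : ∀ p : Submodule ℂ (Fin 3 → ℂ), (∀ g, ∀ v ∈ p, matOf ρf g *ᵥ v ∈ p) → p = ⊥ ∨ p = ⊤ := by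
    simpa only [matOf_mulVec] using hfirr
  have i2 : ∀ p : Submodule ℂ (Fin 3 → ℂ), (∀ g, ∀ v ∈ p, matOf ρl g *ᵥ v ∈ p) → p = ⊥ ∨ p = ⊤ := by
    simpa only [matOf_mulVec] using hlirr
  have H := mkGood (matOf ρf) i1 hperfect hcard hcenter π hsurj hker
  have H' := mkGood (matOf ρl) i2 hperfect hcard hcenter π hsurj hker
  have : Fact (Nat.Prime 3) := ⟨by norm_num⟩
  have : Nontrivial (Subgroup.center G) := by
    apply Finite.one_lt_card_iff_nontrivial.1; rw [hcenter]; norm_num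
  obtain ⟨z0, hz0⟩ := exists_ne (1 : Subgroup.center G)
  have hgen : ∀ z, π z = 1 → ∃ i : ℕ, (z0 : G) ^ i = z := by
    intro z hz
    obtain ⟨i, hi⟩ := mem_powers_of_prime_card hcenter (g := z0) (g' := ⟨z, (hker z).1 hz⟩) hz0
    exact ⟨i, congrArg Subtype.val hi⟩
  rcases H.final H' (sum_trace_zero _ i1) (sum_trace_zero _ i2) z0 ((hker _).2 z0.2) hgen with h | h | h
  · exact absurd (funext fun g => by rw [hf, hlam, ← matOf_trace, ← matOf_trace, h g]) hne
  · exact absurd (funext fun g => by rw [hf, hlam, ← matOf_trace, ← matOf_trace, h g]) hneconj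
  · unfold innerChar
    have e1 : ∀ g, (starRingEnd ℂ) (lam g * f g) * (lam g * f g) =
        ((Complex.normSq (matOf ρf g).trace * Complex.normSq (matOf ρl g).trace : ℝ) : ℂ) := by
      intro g
      rw [hf, hlam, ← matOf_trace, ← matOf_trace, map_mul, Complex.ofReal_mul, ← Complex.mul_conj, ← Complex.mul_conj]
      ring
    rw [Finset.sum_congr rfl (fun g _ => e1 g), ← Complex.ofReal_sum, h, ← Nat.card_eq_fintype_card, hcard]
    norm_num
end
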